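/- arXiv:1511.00571 — 3 statements merged into one kernel-verified Lean document; each statement's English description precedes it below -/
import Mathlib

section
/- Asymptotics of the nonlocal mean value kernel as s ↑ 1: let u ∈ C²(ℝ^N) be bounded, let x ∈ ℝ^N and r > 0. Then lim_{s↑1} ∫_{ℝ^N∖B_r(x)} η_r^{(s)}(y−x)·u(y) dy = (1/(ω_{N−1}·r^{N−1}))·∫_{∂B_r(x)} u(y) dH^{N−1}(y), i.e. the nonlocal mean value of u converges to the classical spherical average of u over ∂B_r(x); here ω_{N−1} = H^{N−1}(S^{N−1}). -/
open MeasureTheory Filter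

/-- The constant `c(N,s) = Γ(N/2)·sin(πs)/π^{1+N/2}`. -/
noncomputable def cK (N : ℕ) (s : ℝ) : ℝ :=
  Real.Gamma ((N : ℝ) / 2) * Real.sin (Real.pi * s) / Real.pi ^ (1 + (N : ℝ) / 2)

/-- The kernel `η_r^{(s)}(x) = c(N,s)·r^{2s}/(|x|^N·(|x|²−r²)^s)` for `|x| > r`,
and `0` for `|x| ≤ r`. -/
noncomputable def eta (N : ℕ) (s r : ℝ) (x : EuclideanSpace ℝ (Fin N)) : ℝ :=
  if r < ‖x‖ then cK N s * r ^ (2 * s) / (‖x‖ ^ N * (‖x‖ ^ 2 - r ^ 2) ^ s) else 0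

/-- Two finite uniformly distributed Borel measures on a compact metric space are proportional, in
the sense that they give proportional integrals of continuous functions (Christensen). -/
theorem integral_proportional_of_measureReal_ball_eq {X : Type*} [MetricSpace X] [CompactSpace X]
    [MeasurableSpace X] [BorelSpace X] (μ ν : Measure X) [IsFiniteMeasure μ] [IsFiniteMeasure ν]
    (hμ : ∀ (δ : ℝ) (p q : X), μ.real (Metric.ball p δ) = μ.real (Metric.ball q δ))
    (hν : ∀ (δ : ℝ) (p q : X), ν.real (Metric.ball p δ) = ν.real (Metric.ball q δ))
    {f : X → ℝ} (hf : Continuous f) :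
    ν.real Set.univ * ∫ x, f x ∂μ = μ.real Set.univ * ∫ x, f x ∂ν := by
  rcases isEmpty_or_nonempty X with hX | ⟨⟨p₀⟩⟩
  · simp [Measure.eq_zero_of_isEmpty]
  rcases eq_or_ne ν 0 with rfl | hν0
  · simp
  have hint : ∀ {g : X → ℝ} (_ : Continuous g) (m : Measure X) [IsFiniteMeasure m],
      Integrable g m := fun hg m _ =>
    hg.integrable_of_hasCompactSupport (HasCompactSupport.of_compactSpace _)
  have fubini : ∀ (δ : ℝ) {g : X → ℝ}, Continuous g →
      ν.real (Metric.ball p₀ δ) * ∫ x, g x ∂μ = ∫ y, ∫ x in Metric.ball y δ, g x ∂μ ∂ν := by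
    intro δ g hg
    have hmeas : MeasurableSet {z : X × X | dist z.1 z.2 < δ} :=
      (isOpen_lt continuous_dist continuous_const).measurableSet
    have hI : Integrable (Function.uncurry fun x y : X =>
        {z : X × X | dist z.1 z.2 < δ}.indicator (fun z => g z.1) (x, y)) (μ.prod ν) := by
      have : Integrable (fun z : X × X => g z.1) (μ.prod ν) :=
        (hg.comp continuous_fst).integrable_of_hasCompactSupport
          (HasCompactSupport.of_compactSpace _)
      exact this.indicator hmeas
    have h := integral_integral_swap hI
    have e1 : ∀ x, ∫ y, {z : X × X | dist z.1 z.2 < δ}.indicator (fun z => g z.1) (x, y) ∂ν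
        = ν.real (Metric.ball p₀ δ) * g x := by
      intro x
      rw [hν δ p₀ x, ← smul_eq_mul, ← integral_indicator_const _ Metric.isOpen_ball.measurableSet]
      congr 1 with y
      simp [Set.indicator, dist_comm]
    have e2 : ∀ y, ∫ x, {z : X × X | dist z.1 z.2 < δ}.indicator (fun z => g z.1) (x, y) ∂μ
        = ∫ x in Metric.ball y δ, g x ∂μ := by
      intro y
      rw [← integral_indicator Metric.isOpen_ball.measurableSet]
      congr 1
    simp only [e1, e2] at h
    rw [← h, integral_const_mul]
  have kpos : ∀ δ > 0, 0 < ν.real (Metric.ball p₀ δ) := by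
    intro δ hδ
    rcases (measureReal_nonneg (μ := ν) (s := Metric.ball p₀ δ)).lt_or_eq with h | h
    · exact h
    exfalso
    apply hν0
    obtain ⟨t, -, htf, ht⟩ := finite_cover_balls_of_compact (isCompact_univ (X := X)) hδ
    refine Measure.measure_univ_eq_zero.1 (measure_mono_null ht ?_)
    refine (measure_biUnion_null_iff htf.countable).2 fun x _ => ?_
    rw [← measureReal_eq_zero_iff, hν δ x p₀, ← h]
  have main : ∀ ε > 0, |ν.real Set.univ * ∫ x, f x ∂μ - μ.real Set.univ * ∫ x, f x ∂ν|
      ≤ ε * (ν.real Set.univ * μ.real Set.univ) := by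
    intro ε hε
    obtain ⟨δ, hδ, hfδ⟩ := Metric.uniformContinuous_iff.1
      (CompactSpace.uniformContinuous_of_continuous hf) ε hε
    set k := ν.real (Metric.ball p₀ δ) with hk
    set h := μ.real (Metric.ball p₀ δ) with hh
    have hkpos : 0 < k := kpos δ hδ
    have hmass : k * μ.real Set.univ = h * ν.real Set.univ := by
      have := fubini δ (continuous_const (y := (1 : ℝ)))
      simp only [integral_const, smul_eq_mul, mul_one, measureReal_restrict_apply,
        MeasurableSet.univ, Set.univ_inter] at this
      rw [this]
      simp_rw [hμ δ _ p₀]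
      simp [mul_comm, hh]
    have hb : |k * ∫ x, f x ∂μ - h * ∫ x, f x ∂ν| ≤ ε * h * ν.real Set.univ := by
      have hG : Integrable (fun y => ∫ x in Metric.ball y δ, f x ∂μ) ν := by
        have hmeas : MeasurableSet {z : X × X | dist z.1 z.2 < δ} :=
          (isOpen_lt continuous_dist continuous_const).measurableSet
        have : Integrable (fun z : X × X => f z.2) (ν.prod μ) :=
          (hf.comp continuous_snd).integrable_of_hasCompactSupport
            (HasCompactSupport.of_compactSpace _)
        refine (this.indicator hmeas).integral_prod_left.congr (.of_forall fun y => ?_)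
        dsimp only
        rw [← integral_indicator Metric.isOpen_ball.measurableSet]
        congr 1 with x
        simp [Set.indicator, dist_comm]
      rw [hk, fubini δ hf, ← integral_const_mul, ← integral_sub hG ((hint hf ν).const_mul _)]
      have := norm_integral_le_of_norm_le_const (μ := ν) (C := ε * h)
        (f := fun y => (∫ x in Metric.ball y δ, f x ∂μ) - h * f y) (.of_forall fun y => ?_)
      · simpa using this
      have e : h * f y = ∫ x in Metric.ball y δ, f y ∂μ := by
        simp [measureReal_restrict_apply, hh, hμ δ p₀ y]
      rw [e, ← integral_sub (hint hf μ).integrableOn (by simp)]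
      have := norm_setIntegral_le_of_norm_le_const (μ := μ) (s := Metric.ball y δ) (C := ε)
        (f := fun x => f x - f y) (measure_lt_top _ _) (fun x hx => (hfδ hx).le)
      rwa [← hμ δ p₀ y] at this
    have : k * |ν.real Set.univ * ∫ x, f x ∂μ - μ.real Set.univ * ∫ x, f x ∂ν|
        ≤ k * (ε * (ν.real Set.univ * μ.real Set.univ)) := by
      calc _ = |ν.real Set.univ * (k * ∫ x, f x ∂μ - h * ∫ x, f x ∂ν)| := by
            rw [← abs_of_pos hkpos, ← abs_mul, abs_of_pos hkpos]
            congr 1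
            linear_combination -(∫ x, f x ∂ν) * hmass
        _ = ν.real Set.univ * |k * ∫ x, f x ∂μ - h * ∫ x, f x ∂ν| := by
            rw [abs_mul, abs_of_nonneg measureReal_nonneg]
        _ ≤ ν.real Set.univ * (ε * h * ν.real Set.univ) := by gcongr
        _ = _ := by linear_combination -(ε * ν.real Set.univ) * hmass
    exact le_of_mul_le_mul_left this hkpos
  rw [← sub_eq_zero, ← abs_nonpos_iff]
  refine ge_of_tendsto (f := fun ε : ℝ => ε * (ν.real Set.univ * μ.real Set.univ))
    (x := nhdsWithin (0 : ℝ) (Set.Ioi 0)) ?_ (eventually_mem_nhdsWithin.mono fun ε hε => main ε hε)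
  refine tendsto_nhdsWithin_of_tendsto_nhds ?_
  exact (continuous_id.mul continuous_const).tendsto' 0 _ (zero_mul _)

section

open scoped RealInnerProductSpace

variable {E : Type*} [NormedAddCommGroup E] [InnerProductSpace ℝ E] [FiniteDimensional ℝ E]
    [MeasurableSpace E] [BorelSpace E]

/-- Near each of its points the unit sphere is the graph of a Lipschitz function over the tangent
hyperplane, hence has locally finite Hausdorff measure of the right dimension. -/
theorem exists_nhds_hausdorffMeasure_sphere_lt_top {n : ℕ} (hn : Module.finrank ℝ E = n + 1)
    {p : E} (hp : ‖p‖ = 1) :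
    ∃ t ∈ nhdsWithin p (Metric.sphere (0 : E) 1), μH[(n : ℝ)] t < ⊤ := by
  have : Fact (Module.finrank ℝ E = n + 1) := ⟨hn⟩
  have hp0 : p ≠ 0 := by rintro rfl; simp at hp
  set F := (ℝ ∙ p)ᗮ with hF
  have hdim : Module.finrank ℝ F = n := Submodule.finrank_orthogonal_span_singleton hp0
  let φ : F → E := fun w => (w : E) + Real.sqrt (1 - ‖w‖ ^ 2) • p
  have hφ : ContDiffAt ℝ 1 φ 0 := by
    refine F.subtypeL.contDiff.contDiffAt.add
      (ContDiffAt.smul (ContDiffAt.sqrt ?_ ?_) contDiffAt_const)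
    · exact contDiffAt_const.sub (contDiff_norm_sq ℝ).contDiffAt
    · simp
  obtain ⟨K, t, ht, hK⟩ := hφ.exists_lipschitzOnWith
  have hfin : μH[(n : ℝ)] (φ '' (t ∩ Metric.ball 0 1)) < ⊤ := by
    refine ((hK.mono Set.inter_subset_left).hausdorffMeasure_image_le (by positivity)).trans_lt ?_
    refine ENNReal.mul_lt_top (by simp) ((measure_mono Set.inter_subset_right).trans_lt ?_)
    rw [← hdim]
    exact measure_ball_lt_top
  refine ⟨_, ?_, hfin⟩
  let P : E → F := F.orthogonalProjectionOnto
  have hP : ContinuousAt P p := F.orthogonalProjectionOnto.continuous.continuousAt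
  have hPp : P p = 0 := by
    simp [P, hF]
  have h1 : ∀ᶠ θ in nhds p, P θ ∈ t ∩ Metric.ball 0 1 :=
    hP.eventually_mem (by rw [hPp]; exact inter_mem ht (Metric.ball_mem_nhds _ one_pos))
  have h2 : ∀ᶠ θ in nhds p, 0 < ⟪p, θ⟫ := by
    refine (continuous_const.inner continuous_id).continuousAt.eventually_mem (Ioi_mem_nhds ?_)
    simp [hp]
  filter_upwards [nhdsWithin_le_nhds h1, nhdsWithin_le_nhds h2, self_mem_nhdsWithin] with θ ha hb hc
  refine ⟨P θ, ha, ?_⟩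
  have hc : ‖θ‖ = 1 := by simpa using hc
  have hsplit : (P θ : E) = θ - ⟪p, θ⟫ • p := by
    have h := (ℝ ∙ p).starProjection_orthogonal_val θ
    rwa [Submodule.starProjection_unit_singleton ℝ hp] at h
  have hnorm : ‖P θ‖ ^ 2 = 1 - ⟪p, θ⟫ ^ 2 := by
    change ‖(P θ : E)‖ ^ 2 = _
    rw [hsplit, norm_sub_sq_real, hc, norm_smul, hp, inner_smul_right, real_inner_comm]
    simp
    ring
  simp only [φ, hnorm, hsplit]
  rw [sub_sub_cancel, Real.sqrt_sq hb.le]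
  abel

theorem hausdorffMeasure_sphere_lt_top {n : ℕ} (hn : Module.finrank ℝ E = n + 1) :
    μH[(n : ℝ)] (Metric.sphere (0 : E) 1) < ⊤ :=
  (isCompact_sphere 0 1).measure_lt_top_of_nhdsWithin fun p hp =>
    exists_nhds_hausdorffMeasure_sphere_lt_top hn (by simpa using hp)

theorem hausdorffMeasure_sphere_pos {n : ℕ} (hn : Module.finrank ℝ E = n + 1) :
    0 < μH[(n : ℝ)] (Metric.sphere (0 : E) 1) := by
  have : Fact (Module.finrank ℝ E = n + 1) := ⟨hn⟩
  have : Nontrivial E := Module.nontrivial_of_finrank_pos (R := ℝ) (by omega)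
  obtain ⟨p, hp⟩ := exists_norm_eq E (zero_le_one (α := ℝ))
  have hp0 : p ≠ 0 := by rintro rfl; simp at hp
  set F := (ℝ ∙ p)ᗮ with hF
  have hdim : Module.finrank ℝ F = n := Submodule.finrank_orthogonal_span_singleton hp0
  have hsub : Metric.ball (0 : F) 1 ⊆ F.orthogonalProjectionOnto '' Metric.sphere (0 : E) 1 := by
    intro w hw
    have hw : ‖w‖ < 1 := by simpa using hw
    have hw2 : ‖w‖ ^ 2 ≤ 1 := by nlinarith [norm_nonneg w]
    refine ⟨(w : E) + Real.sqrt (1 - ‖w‖ ^ 2) • p, ?_, ?_⟩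
    · have ho : ⟪(w : E), p⟫ = 0 := by
        rw [real_inner_comm]; exact (Submodule.mem_orthogonal_singleton_iff_inner_right).1 w.2
      have : ‖(w : E) + Real.sqrt (1 - ‖w‖ ^ 2) • p‖ ^ 2 = 1 := by
        rw [norm_add_sq_real, inner_smul_right, ho, norm_smul, hp]
        simp only [Submodule.coe_norm, Real.norm_eq_abs, mul_zero, add_zero, mul_one, sq_abs]
        rw [Real.sq_sqrt (sub_nonneg.2 (by simpa using hw2))]
        ring
      rw [mem_sphere_zero_iff_norm]
      exact (pow_eq_one_iff_of_nonneg (norm_nonneg _) two_ne_zero).1 this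
    · simp [hF]
  have hball : 0 < μH[(n : ℝ)] (Metric.ball (0 : F) 1) := by
    rw [← hdim]
    exact Metric.measure_ball_pos _ _ one_pos
  refine hball.trans_le ((measure_mono hsub).trans ?_)
  exact hausdorffMeasure_orthogonalProjectionOnto_le _ _ _ (by positivity)

end

section

open scoped RealInnerProductSpace Pointwise

variable {E : Type*} [NormedAddCommGroup E] [InnerProductSpace ℝ E]

theorem LinearIsometryEquiv.image_image_val_ball_unitSphere (A : E ≃ₗᵢ[ℝ] E)
    {p q : Metric.sphere (0 : E) 1} (h : A p = q) (δ : ℝ) :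
    A '' (Subtype.val '' Metric.ball p δ) = Subtype.val '' Metric.ball q δ := by
  rw [Subtype.image_ball, Subtype.image_ball]
  ext z
  constructor
  · rintro ⟨y, ⟨hy, hy'⟩, rfl⟩
    refine ⟨?_, ?_⟩
    · rw [← h, Metric.mem_ball, A.dist_map]; exact hy
    · simpa using hy'
  · rintro ⟨hy, hy'⟩
    refine ⟨A.symm z, ⟨?_, ?_⟩, by simp⟩
    · rw [← h, Metric.mem_ball] at hy
      rw [Metric.mem_ball, ← A.dist_map]
      simpa using hy
    · simpa using hy'

theorem exists_linearIsometryEquiv_apply_eq {p q : E} (h : ‖p‖ = ‖q‖) :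
    ∃ A : E ≃ₗᵢ[ℝ] E, A p = q :=
  ⟨Submodule.reflection (ℝ ∙ (p - q))ᗮ, Submodule.reflection_sub h⟩

variable [MeasurableSpace E] [BorelSpace E]

theorem hausdorffMeasure_ball_unitSphere_eq {d : ℝ} (hd : 0 ≤ d) (δ : ℝ)
    (p q : Metric.sphere (0 : E) 1) :
    μH[d] (Metric.ball p δ) = μH[d] (Metric.ball q δ) := by
  obtain ⟨A, hA⟩ := exists_linearIsometryEquiv_apply_eq (p := (p : E)) (q := q) (by simp)
  rw [← isometry_subtype_coe.hausdorffMeasure_image (.inl hd),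
    ← isometry_subtype_coe.hausdorffMeasure_image (.inl hd) (Metric.ball q δ),
    ← A.image_image_val_ball_unitSphere hA, A.isometry.hausdorffMeasure_image (.inl hd)]

theorem toSphere_ball_eq (μ : Measure E) (hμ : ∀ A : E ≃ₗᵢ[ℝ] E, MeasurePreserving A μ μ)
    (δ : ℝ) (p q : Metric.sphere (0 : E) 1) :
    μ.toSphere (Metric.ball p δ) = μ.toSphere (Metric.ball q δ) := by
  obtain ⟨A, hA⟩ := exists_linearIsometryEquiv_apply_eq (p := (p : E)) (q := q) (by simp)
  rw [Measure.toSphere_apply' _ Metric.isOpen_ball.measurableSet,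
    Measure.toSphere_apply' _ Metric.isOpen_ball.measurableSet,
    ← A.image_image_val_ball_unitSphere hA]
  have : Set.Ioo (0 : ℝ) 1 • (A '' (Subtype.val '' Metric.ball p δ))
      = A '' (Set.Ioo (0 : ℝ) 1 • (Subtype.val '' Metric.ball p δ)) := by
    ext z
    simp only [Set.mem_smul, Set.mem_image]
    constructor
    · rintro ⟨t, ht, _, ⟨y, hy, rfl⟩, rfl⟩
      exact ⟨t • y, ⟨t, ht, y, hy, rfl⟩, by simp⟩
    · rintro ⟨_, ⟨t, ht, y, hy, rfl⟩, rfl⟩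
      exact ⟨t, ht, A y, ⟨y, hy, rfl⟩, by simp⟩
  rw [this]
  congr 1
  have h := (hμ A.symm).measure_preimage_emb A.symm.toHomeomorph.measurableEmbedding
    (Set.Ioo (0 : ℝ) 1 • (Subtype.val '' Metric.ball p δ))
  rw [← h, A.image_eq_preimage_symm]

/-- Integration over a sphere of radius `r`, rescaled to the unit sphere. -/
theorem setIntegral_sphere_hausdorffMeasure (n : ℕ) (u : E → ℝ) (x : E) {r : ℝ} (hr : 0 < r) :
    ∫ y in Metric.sphere x r, u y ∂μH[(n : ℝ)]
      = r ^ n * ∫ θ : Metric.sphere (0 : E) 1, u (x + r • (θ : E)) ∂μH[(n : ℝ)] := by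
  let h : E ≃ₜ E := (Homeomorph.smulOfNeZero r hr.ne').trans (Homeomorph.addLeft x)
  have hmap : Measure.map h μH[(n : ℝ)] = ENNReal.ofReal (r⁻¹ ^ n) • μH[(n : ℝ)] := by
    ext s hs
    have e : h ⁻¹' s = r⁻¹ • (IsometryEquiv.addLeft x ⁻¹' s) := by
      ext z
      rw [Set.mem_smul_set_iff_inv_smul_mem₀ (inv_ne_zero hr.ne'), inv_inv]
      rfl
    rw [Measure.map_apply h.continuous.measurable hs, e,
      Measure.hausdorffMeasure_smul₀ n.cast_nonneg (inv_ne_zero hr.ne'),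
      IsometryEquiv.hausdorffMeasure_preimage, Measure.smul_apply, NNReal.rpow_natCast,
      ENNReal.smul_def, smul_eq_mul, smul_eq_mul, ENNReal.ofReal]
    congr 3
    ext
    rw [Real.coe_toNNReal _ (by positivity)]
    simp [abs_of_pos hr]
  have hpre : h ⁻¹' Metric.sphere x r = Metric.sphere 0 1 := by
    ext z
    simp [h, norm_smul, abs_of_pos hr, hr.ne']
  have h1 := h.measurableEmbedding.setIntegral_map (μ := μH[(n : ℝ)]) u (Metric.sphere x r)
  rw [hmap, hpre, Measure.restrict_smul, integral_smul_measure] at h1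
  have h2 := (MeasurableEmbedding.subtype_coe
    (Metric.isClosed_sphere (x := (0 : E)) (ε := 1)).measurableSet).integral_map (μ := μH[(n : ℝ)])
    (fun z => u (h z))
  rw [isometry_subtype_coe.map_hausdorffMeasure (.inl n.cast_nonneg), Subtype.range_coe] at h2
  rw [h2, ENNReal.toReal_ofReal (by positivity), smul_eq_mul] at h1
  change _ = r ^ n * ∫ θ : Metric.sphere (0 : E) 1, u (h θ) ∂μH[(n : ℝ)]
  rw [← h1, ← mul_assoc, ← mul_pow, mul_inv_cancel₀ hr.ne', one_pow, one_mul]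

end

/-- Integration in polar coordinates of a product of a function of the norm and a function of the
direction. -/
theorem integral_fun_norm_mul_fun_direction {E : Type*} [NormedAddCommGroup E] [NormedSpace ℝ E]
    [Nontrivial E] [FiniteDimensional ℝ E] [MeasurableSpace E] [BorelSpace E] (μ : Measure E)
    [μ.IsAddHaarMeasure] (g : ℝ → ℝ) (f : E → ℝ) :
    ∫ z, g ‖z‖ * f (‖z‖⁻¹ • z) ∂μ
      = (∫ y in Set.Ioi (0 : ℝ), y ^ (Module.finrank ℝ E - 1) * g y)
        * ∫ θ : Metric.sphere (0 : E) 1, f θ ∂μ.toSphere := by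
  calc
    _ = ∫ z : ({(0)}ᶜ : Set E), g ‖z.1‖ * f (‖z.1‖⁻¹ • z.1) ∂(μ.comap (↑)) := by
      rw [integral_subtype_comap (measurableSet_singleton _).compl
        fun z => g ‖z‖ * f (‖z‖⁻¹ • z), restrict_compl_singleton]
    _ = ∫ w : Metric.sphere (0 : E) 1 × Set.Ioi (0 : ℝ), f w.1 * g w.2
          ∂μ.toSphere.prod (.volumeIoiPow (Module.finrank ℝ E - 1)) := by
      rw [← μ.measurePreserving_homeomorphUnitSphereProd.integral_comp
        (Homeomorph.measurableEmbedding _)]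
      simp [mul_comm]
    _ = (∫ θ : Metric.sphere (0 : E) 1, f θ ∂μ.toSphere)
          * ∫ y : Set.Ioi (0 : ℝ), g y ∂.volumeIoiPow (Module.finrank ℝ E - 1) :=
      integral_prod_mul (fun θ : Metric.sphere (0 : E) 1 => f θ) (fun y : Set.Ioi (0 : ℝ) => g y)
    _ = _ := by
      rw [mul_comm]
      congr 1
      simp only [Measure.volumeIoiPow, ENNReal.ofReal]
      rw [integral_withDensity_eq_integral_smul,
        integral_subtype_comap measurableSet_Ioi
          fun a ↦ Real.toNNReal (a ^ (Module.finrank ℝ E - 1)) • g a,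
        setIntegral_congr_fun measurableSet_Ioi fun x hx ↦ ?_]
      · rw [NNReal.smul_def, Real.coe_toNNReal _ (pow_nonneg hx.out.le _), smul_eq_mul]
      · exact (measurable_subtype_coe.pow_const _).real_toNNReal

theorem image_sq_sub_sq_div_sq_Ioi {r : ℝ} (hr : 0 < r) :
    (fun y : ℝ => (y ^ 2 - r ^ 2) / r ^ 2) '' Set.Ioi r = Set.Ioi 0 := by
  ext t
  constructor
  · rintro ⟨y, hy, rfl⟩
    have hy : r < y := hy
    have : 0 < y ^ 2 - r ^ 2 := by nlinarith
    exact div_pos this (by positivity)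
  · intro ht
    have ht : 0 < t := ht
    refine ⟨r * √(1 + t), ?_, ?_⟩
    · have : 1 < √(1 + t) := Real.lt_sqrt_of_sq_lt (by linarith)
      show r < _
      nlinarith
    · dsimp only
      rw [mul_pow, Real.sq_sqrt (by linarith)]
      field_simp
      ring

theorem injOn_sq_sub_sq_div_sq_Ioi {r : ℝ} (hr : 0 < r) :
    Set.InjOn (fun y : ℝ => (y ^ 2 - r ^ 2) / r ^ 2) (Set.Ioi r) := by
  intro a ha b hb h
  have ha : r < a := ha
  have hb : r < b := hb
  dsimp only at h
  field_simp at h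
  exact (sq_eq_sq₀ (by linarith) (by linarith)).1 (by linarith)

theorem hasDerivWithinAt_sq_sub_sq_div_sq (r y : ℝ) (s : Set ℝ) :
    HasDerivWithinAt (fun y : ℝ => (y ^ 2 - r ^ 2) / r ^ 2) (2 * y / r ^ 2) s y := by
  have := (((hasDerivAt_pow 2 y).sub_const (r ^ 2)).div_const (r ^ 2)).hasDerivWithinAt (s := s)
  simpa using this

/-- The radial profile of the kernel, written in terms of the variable `t = (y² - r²) / r²`. -/
theorem pow_mul_radial_kernel_eq {N : ℕ} (hN : 1 ≤ N) {r s c y w : ℝ} (hr : 0 < r) (hy : r < y) :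
    y ^ (N - 1) * (c * r ^ (2 * s) / (y ^ N * (y ^ 2 - r ^ 2) ^ s) * w)
      = c / 2 * (|2 * y / r ^ 2| •
        (((y ^ 2 - r ^ 2) / r ^ 2) ^ (-s) / (1 + (y ^ 2 - r ^ 2) / r ^ 2) * w)) := by
  have hy0 : 0 < y := hr.trans hy
  have hp : 0 < y ^ 2 - r ^ 2 := by nlinarith
  obtain ⟨n, rfl⟩ : ∃ n, N = n + 1 := ⟨N - 1, by omega⟩
  have e1 : (r ^ 2) ^ s = r ^ (2 * s) := by
    rw [← Real.rpow_natCast, ← Real.rpow_mul hr.le]; norm_num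
  have e2 : 1 + (y ^ 2 - r ^ 2) / r ^ 2 = y ^ 2 / r ^ 2 := by field_simp; ring
  rw [Real.rpow_neg (by positivity), Real.div_rpow hp.le (by positivity), e1, e2,
    abs_of_pos (by positivity), smul_eq_mul, Nat.add_sub_cancel]
  have := Real.rpow_pos_of_pos hr (2 * s)
  have := Real.rpow_pos_of_pos hp s
  field_simp
  ring

theorem setIntegral_Ioi_radial_kernel {N : ℕ} (hN : 1 ≤ N) {r s : ℝ} (c : ℝ) (hr : 0 < r)
    (w : ℝ → ℝ) :
    ∫ y in Set.Ioi (0 : ℝ), y ^ (N - 1) *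
        ((if r < y then c * r ^ (2 * s) / (y ^ N * (y ^ 2 - r ^ 2) ^ s) else 0)
          * w ((y ^ 2 - r ^ 2) / r ^ 2))
      = c / 2 * ∫ t in Set.Ioi (0 : ℝ), t ^ (-s) / (1 + t) * w t := by
  have h := integral_image_eq_integral_abs_deriv_smul measurableSet_Ioi
    (fun y _ => hasDerivWithinAt_sq_sub_sq_div_sq r y _) (injOn_sq_sub_sq_div_sq_Ioi hr)
    (fun t => t ^ (-s) / (1 + t) * w t)
  rw [image_sq_sub_sq_div_sq_Ioi hr] at h
  rw [h, ← integral_const_mul, setIntegral_eq_of_subset_of_forall_sdiff_eq_zero measurableSet_Ioi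
    (Set.Ioi_subset_Ioi hr.le)]
  · refine setIntegral_congr_fun measurableSet_Ioi fun y hy => ?_
    have hy : r < y := hy
    simp only [if_pos hy]
    exact pow_mul_radial_kernel_eq hN hr hy
  · rintro y ⟨-, hy⟩
    have : ¬ r < y := hy
    simp [this]

theorem integrableOn_Ioi_radial_kernel {N : ℕ} (hN : 1 ≤ N) {r s : ℝ} (c : ℝ) (hr : 0 < r)
    (w : ℝ → ℝ)
    (h : IntegrableOn (fun t => t ^ (-s) / (1 + t) * w t) (Set.Ioi 0)) :
    IntegrableOn (fun y => y ^ (N - 1) *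
        ((if r < y then c * r ^ (2 * s) / (y ^ N * (y ^ 2 - r ^ 2) ^ s) else 0)
          * w ((y ^ 2 - r ^ 2) / r ^ 2))) (Set.Ioi 0) := by
  rw [← image_sq_sub_sq_div_sq_Ioi hr,
    integrableOn_image_iff_integrableOn_abs_deriv_smul measurableSet_Ioi
    (fun y _ => hasDerivWithinAt_sq_sub_sq_div_sq r y _) (injOn_sq_sub_sq_div_sq_Ioi hr)] at h
  refine IntegrableOn.of_forall_sdiff_eq_zero (s := Set.Ioi r) ?_ measurableSet_Ioi ?_
  · refine IntegrableOn.congr_fun (h.const_mul (c / 2)) (fun y hy => ?_) measurableSet_Ioi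
    have hy : r < y := hy
    simp only [if_pos hy]
    exact (pow_mul_radial_kernel_eq hN hr hy).symm
  · rintro y ⟨-, hy⟩
    have : ¬ r < y := hy
    simp [this]

/-- The mass of `t ^ (-s) / (1 + t)` is `1 / (1 - s)` up to an error that stays bounded as `s ↑ 1`,
while its mass weighted by `min 1 t` stays bounded. -/
theorem rpow_neg_div_one_add_bounds {s : ℝ} (hs : s ∈ Set.Ioo (0 : ℝ) 1) :
    IntegrableOn (fun t : ℝ => t ^ (-s) / (1 + t)) (Set.Ioi 0) ∧
    IntegrableOn (fun t : ℝ => t ^ (-s) / (1 + t) * min 1 t) (Set.Ioi 0) ∧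
    0 ≤ ∫ t in Set.Ioi (0 : ℝ), t ^ (-s) / (1 + t) * min 1 t ∧
    ∫ t in Set.Ioi (0 : ℝ), t ^ (-s) / (1 + t) * min 1 t ≤ 1 + 1 / s ∧
    |(∫ t in Set.Ioi (0 : ℝ), t ^ (-s) / (1 + t)) - 1 / (1 - s)| ≤ 1 + 1 / s := by
  obtain ⟨hs0, hs1⟩ := hs
  have hmeas : Measurable fun t : ℝ => t ^ (-s) / (1 + t) := by fun_prop
  have hmeas' : Measurable fun t : ℝ => t ^ (-s) / (1 + t) * min 1 t := by fun_prop
  have i1 : IntegrableOn (fun t : ℝ => t ^ (-s)) (Set.Ioc 0 1) := by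
    rw [← intervalIntegrable_iff_integrableOn_Ioc_of_le zero_le_one]
    exact intervalIntegral.intervalIntegrable_rpow' (by linarith)
  have v1 : ∫ t in Set.Ioc (0 : ℝ) 1, t ^ (-s) = 1 / (1 - s) := by
    rw [← intervalIntegral.integral_of_le zero_le_one, integral_rpow (.inl (by linarith)),
      Real.zero_rpow (by linarith), Real.one_rpow]
    ring_nf
  have i2 : IntegrableOn (fun t : ℝ => t ^ (-s - 1)) (Set.Ioi 1) :=
    integrableOn_Ioi_rpow_of_lt (by linarith) one_pos
  have v2 : ∫ t in Set.Ioi (1 : ℝ), t ^ (-s - 1) = 1 / s := by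
    rw [integral_Ioi_rpow_of_lt (by linarith) one_pos, Real.one_rpow]
    rw [sub_add_cancel, neg_div_neg_eq]
  have b1 : ∀ t ∈ Set.Ioc (0 : ℝ) 1, t ^ (-s) / (1 + t) ≤ t ^ (-s) := fun t ht =>
    div_le_self (Real.rpow_nonneg ht.1.le _) (by linarith [ht.1])
  have b2 : ∀ t ∈ Set.Ioi (1 : ℝ), t ^ (-s) / (1 + t) ≤ t ^ (-s - 1) := fun t ht => by
    have ht : 1 < t := ht
    rw [Real.rpow_sub_one (by linarith)]
    gcongr
    linarith
  have b3 : ∀ t ∈ Set.Ioc (0 : ℝ) 1, t ^ (-s) * t ≤ 1 := fun t ht => by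
    rw [← Real.rpow_add_one ht.1.ne']
    exact Real.rpow_le_one ht.1.le ht.2 (by linarith)
  have nn : ∀ t : ℝ, 0 < t → 0 ≤ t ^ (-s) / (1 + t) := fun t ht => by positivity
  have j1 : IntegrableOn (fun t : ℝ => t ^ (-s) / (1 + t)) (Set.Ioc 0 1) :=
    i1.mono' hmeas.aestronglyMeasurable <| (ae_restrict_mem measurableSet_Ioc).mono fun t ht => by
      rw [Real.norm_of_nonneg (nn t ht.1)]; exact b1 t ht
  have j2 : IntegrableOn (fun t : ℝ => t ^ (-s) / (1 + t)) (Set.Ioi 1) :=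
    i2.mono' hmeas.aestronglyMeasurable <| (ae_restrict_mem measurableSet_Ioi).mono fun t ht => by
      rw [Real.norm_of_nonneg (nn t (zero_lt_one.trans ht))]; exact b2 t ht
  have hU : Set.Ioc (0 : ℝ) 1 ∪ Set.Ioi 1 = Set.Ioi 0 := Set.Ioc_union_Ioi_eq_Ioi zero_le_one
  have hD : Disjoint (Set.Ioc (0 : ℝ) 1) (Set.Ioi 1) := Set.Ioc_disjoint_Ioi le_rfl
  have j : IntegrableOn (fun t : ℝ => t ^ (-s) / (1 + t)) (Set.Ioi 0) := hU ▸ j1.union j2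
  have k : IntegrableOn (fun t : ℝ => t ^ (-s) / (1 + t) * min 1 t) (Set.Ioi 0) :=
    j.mono' hmeas'.aestronglyMeasurable <| (ae_restrict_mem measurableSet_Ioi).mono fun t ht => by
      have ht : 0 < t := ht
      rw [Real.norm_of_nonneg (mul_nonneg (nn t ht) (by positivity))]
      exact mul_le_of_le_one_right (nn t ht) (min_le_left _ _)
  have hle1 : IntegrableOn (fun _ : ℝ => (1 : ℝ)) (Set.Ioc 0 1) := by simp
  have w2 : ∫ t in Set.Ioi (1 : ℝ), t ^ (-s) / (1 + t) ≤ 1 / s := by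
    rw [← v2]; exact setIntegral_mono_on j2 i2 measurableSet_Ioi b2
  have w2' : 0 ≤ ∫ t in Set.Ioi (1 : ℝ), t ^ (-s) / (1 + t) :=
    setIntegral_nonneg measurableSet_Ioi fun t ht => nn t (zero_lt_one.trans ht)
  have w1 : ∫ t in Set.Ioc (0 : ℝ) 1, t ^ (-s) / (1 + t) ≤ 1 / (1 - s) := by
    rw [← v1]; exact setIntegral_mono_on j1 i1 measurableSet_Ioc b1
  have w1' : 1 / (1 - s) - 1 ≤ ∫ t in Set.Ioc (0 : ℝ) 1, t ^ (-s) / (1 + t) := by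
    have : ∫ t in Set.Ioc (0 : ℝ) 1, (t ^ (-s) - 1)
        ≤ ∫ t in Set.Ioc (0 : ℝ) 1, t ^ (-s) / (1 + t) := by
      refine setIntegral_mono_on (i1.sub hle1) j1 measurableSet_Ioc fun t ht => ?_
      have := b3 t ht
      have h0 := ht.1
      rw [le_div_iff₀ (by linarith)]
      nlinarith
    rw [integral_sub i1 hle1, v1] at this
    simpa using this
  refine ⟨j, k, ?_, ?_, ?_⟩
  · exact setIntegral_nonneg measurableSet_Ioi fun t ht =>
      mul_nonneg (nn t ht) (le_min zero_le_one (le_of_lt ht))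
  · rw [← hU] at k ⊢
    rw [setIntegral_union hD measurableSet_Ioi (k.mono_set Set.subset_union_left)
      (k.mono_set Set.subset_union_right)]
    refine add_le_add ?_ (le_trans ?_ w2)
    · have : ∫ t in Set.Ioc (0 : ℝ) 1, t ^ (-s) / (1 + t) * min 1 t
          ≤ ∫ t in Set.Ioc (0 : ℝ) 1, 1 := by
        refine setIntegral_mono_on (k.mono_set Set.subset_union_left) hle1 measurableSet_Ioc
          fun t ht => ?_
        have h0 := ht.1
        rw [min_eq_right ht.2]
        calc _ ≤ t ^ (-s) * t := by gcongr; exact b1 t ht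
          _ ≤ 1 := b3 t ht
      simpa using this
    · refine setIntegral_mono_on (k.mono_set Set.subset_union_right) j2 measurableSet_Ioi
          fun t ht => ?_
      exact mul_le_of_le_one_right (nn t (zero_lt_one.trans ht)) (min_le_left _ _)
  · rw [← hU, setIntegral_union hD measurableSet_Ioi j1 j2, abs_le]
    have : 0 < 1 / s := by positivity
    constructor <;> linarith

theorem tendsto_sin_pi_mul_div_one_sub :
    Tendsto (fun s : ℝ => Real.sin (Real.pi * s) / Real.pi * (1 / (1 - s)))
      (nhdsWithin 1 (Set.Ioo 0 1)) (nhds 1) := by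
  have h : HasDerivAt (fun s : ℝ => Real.sin (Real.pi * s)) (-Real.pi) 1 := by
    have := ((hasDerivAt_id (1 : ℝ)).const_mul Real.pi).sin
    simpa using this
  have := (h.tendsto_slope.const_mul (-Real.pi⁻¹)).mono_left
    (nhdsWithin_mono 1 (s := Set.Ioo 0 1) fun s hs => hs.2.ne)
  rw [neg_mul_neg, inv_mul_cancel₀ Real.pi_ne_zero] at this
  refine this.congr' (eventually_mem_nhdsWithin.mono fun s hs => ?_)
  have h1 : 1 - s ≠ 0 := by linarith [hs.2]
  have h2 : s - 1 ≠ 0 := by linarith [hs.2]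
  rw [slope_def_field, mul_one, Real.sin_pi, sub_zero, ← neg_sub 1 s]
  field_simp

theorem tendsto_sin_mul_integral_rpow_neg_div_one_add :
    Tendsto (fun s : ℝ => Real.sin (Real.pi * s) / Real.pi *
        ∫ t in Set.Ioi (0 : ℝ), t ^ (-s) / (1 + t))
      (nhdsWithin 1 (Set.Ioo 0 1)) (nhds 1) ∧
    Tendsto (fun s : ℝ => Real.sin (Real.pi * s) / Real.pi *
        ∫ t in Set.Ioi (0 : ℝ), t ^ (-s) / (1 + t) * min 1 t)
      (nhdsWithin 1 (Set.Ioo 0 1)) (nhds 0) := by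
  have h0 : Tendsto (fun s : ℝ => Real.sin (Real.pi * s) / Real.pi * (1 + 1 / s))
      (nhdsWithin 1 (Set.Ioo 0 1)) (nhds 0) := by
    have : ContinuousAt (fun s : ℝ => Real.sin (Real.pi * s) / Real.pi * (1 + 1 / s)) 1 := by
      fun_prop (disch := norm_num)
    simpa using this.tendsto.mono_left nhdsWithin_le_nhds
  have hsin : ∀ s ∈ Set.Ioo (0 : ℝ) 1, 0 ≤ Real.sin (Real.pi * s) / Real.pi := fun s hs =>
    div_nonneg (Real.sin_nonneg_of_nonneg_of_le_pi (mul_nonneg Real.pi_pos.le hs.1.le)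
      (mul_le_of_le_one_right Real.pi_pos.le hs.2.le)) Real.pi_pos.le
  constructor
  · have h1 : Tendsto (fun s : ℝ => Real.sin (Real.pi * s) / Real.pi *
        ((∫ t in Set.Ioi (0 : ℝ), t ^ (-s) / (1 + t)) - 1 / (1 - s)))
        (nhdsWithin 1 (Set.Ioo 0 1)) (nhds 0) := by
      refine squeeze_zero_norm' (eventually_mem_nhdsWithin.mono fun s hs => ?_) h0
      rw [norm_mul, Real.norm_of_nonneg (hsin s hs)]
      exact mul_le_mul_of_nonneg_left (rpow_neg_div_one_add_bounds hs).2.2.2.2 (hsin s hs)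
    simpa [mul_sub] using h1.add tendsto_sin_pi_mul_div_one_sub
  · refine squeeze_zero' (eventually_mem_nhdsWithin.mono fun s hs => ?_)
      (eventually_mem_nhdsWithin.mono fun s hs => ?_) h0
    · exact mul_nonneg (hsin s hs) (rpow_neg_div_one_add_bounds hs).2.2.1
    · exact mul_le_mul_of_nonneg_left (rpow_neg_div_one_add_bounds hs).2.2.2.1 (hsin s hs)

theorem hausdorffMeasure_unitSphere_univ {E : Type*} [NormedAddCommGroup E]
    [MeasurableSpace E] [BorelSpace E] {d : ℝ} (hd : 0 ≤ d) :
    μH[d] (Set.univ : Set (Metric.sphere (0 : E) 1)) = μH[d] (Metric.sphere (0 : E) 1) := by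
  rw [← isometry_subtype_coe.hausdorffMeasure_image (.inl hd), Set.image_univ, Subtype.range_coe]

/-- The average over the unit sphere for the surface measure of a rotation-invariant Haar measure
is the average for the Hausdorff measure. -/
theorem toSphere_average_eq_hausdorffMeasure_average {E : Type*} [NormedAddCommGroup E]
    [InnerProductSpace ℝ E] [FiniteDimensional ℝ E] [MeasurableSpace E] [BorelSpace E]
    {n : ℕ} (hn : Module.finrank ℝ E = n + 1) (μ : Measure E) [μ.IsAddHaarMeasure]
    (hμ : ∀ A : E ≃ₗᵢ[ℝ] E, MeasurePreserving A μ μ)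
    {f : Metric.sphere (0 : E) 1 → ℝ} (hf : Continuous f) :
    (∫ θ, f θ ∂μ.toSphere) / μ.toSphere.real Set.univ
      = (∫ θ, f θ ∂μH[(n : ℝ)]) / (μH[(n : ℝ)] (Metric.sphere (0 : E) 1)).toReal := by
  have : Nontrivial E := Module.nontrivial_of_finrank_pos (R := ℝ) (by omega)
  have hH := hausdorffMeasure_unitSphere_univ (E := E) (d := n) n.cast_nonneg
  have : IsFiniteMeasure (μH[(n : ℝ)] : Measure (Metric.sphere (0 : E) 1)) :=
    ⟨hH ▸ hausdorffMeasure_sphere_lt_top hn⟩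
  have h := integral_proportional_of_measureReal_ball_eq μH[(n : ℝ)] μ.toSphere
    (fun δ p q => by
      simp only [Measure.real, hausdorffMeasure_ball_unitSphere_eq n.cast_nonneg δ p q])
    (fun δ p q => by simp only [Measure.real, toSphere_ball_eq μ hμ δ p q]) hf
  have h1 : μ.toSphere.real Set.univ ≠ 0 := by
    rw [ne_eq, measureReal_eq_zero_iff, Measure.measure_univ_eq_zero]
    exact Measure.toSphere_ne_zero μ
  have h2 : (μH[(n : ℝ)] (Metric.sphere (0 : E) 1)).toReal ≠ 0 :=
    (ENNReal.toReal_pos (hausdorffMeasure_sphere_pos hn).ne'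
      (hausdorffMeasure_sphere_lt_top hn).ne).ne'
  rw [Measure.real, Measure.real, hH] at h
  rw [Measure.real] at h1 ⊢
  field_simp
  linarith

/-- A bounded `C¹` function differs from its radial projection to the sphere of radius `r` by a
quantity vanishing linearly at the sphere and bounded at infinity. -/
theorem exists_abs_sub_radial_projection_le {E : Type*} [NormedAddCommGroup E]
    [InnerProductSpace ℝ E] [FiniteDimensional ℝ E] {u : E → ℝ} (hu : ContDiff ℝ 1 u)
    (hbdd : ∃ M : ℝ, ∀ x, |u x| ≤ M) (x : E) {r : ℝ} (hr : 0 < r) :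
    ∃ C : ℝ, ∀ z : E, r < ‖z‖ →
      |u (x + z) - u (x + r • ‖z‖⁻¹ • z)| ≤ C * min 1 ((‖z‖ ^ 2 - r ^ 2) / r ^ 2) := by
  obtain ⟨M, hM⟩ := hbdd
  have hM0 : 0 ≤ M := (abs_nonneg _).trans (hM 0)
  obtain ⟨K, hK⟩ := hu.contDiffOn.exists_lipschitzOnWith one_ne_zero
    (convex_closedBall x (2 * r)) (isCompact_closedBall x (2 * r))
  refine ⟨K * r + 2 * M, fun z hz => ?_⟩
  have hz0 : 0 < ‖z‖ := hr.trans hz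
  rcases le_or_gt ((‖z‖ ^ 2 - r ^ 2) / r ^ 2) 1 with ht | ht
  · rw [min_eq_right ht]
    have ht' : ‖z‖ ^ 2 - r ^ 2 ≤ r ^ 2 := by rwa [div_le_one (by positivity)] at ht
    have hz2 : ‖z‖ ≤ 2 * r := by nlinarith
    have hnorm : ‖r • ‖z‖⁻¹ • z‖ = r := by
      rw [norm_smul, norm_smul, norm_inv, norm_norm, inv_mul_cancel₀ hz0.ne', mul_one,
        Real.norm_of_nonneg hr.le]
    have h1 := hK.dist_le_mul (x + z) (by simpa using hz2) (x + r • ‖z‖⁻¹ • z)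
      (by rw [mem_closedBall_iff_norm, add_sub_cancel_left, hnorm]; linarith)
    have h2 : dist (x + z) (x + r • ‖z‖⁻¹ • z) = ‖z‖ - r := by
      rw [dist_add_left, dist_eq_norm]
      have : z - r • ‖z‖⁻¹ • z = ((‖z‖ - r) * ‖z‖⁻¹) • z := by
        rw [sub_mul, mul_inv_cancel₀ hz0.ne', sub_smul, one_smul, smul_smul]
      rw [this, norm_smul, norm_mul, norm_inv, norm_norm, mul_assoc, inv_mul_cancel₀ hz0.ne',
        mul_one, Real.norm_of_nonneg (by linarith)]
    have h3 : ‖z‖ - r ≤ r * ((‖z‖ ^ 2 - r ^ 2) / r ^ 2) := by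
      field_simp
      nlinarith
    have h4 : 0 ≤ (‖z‖ ^ 2 - r ^ 2) / r ^ 2 := div_nonneg (by nlinarith) (by positivity)
    rw [h2, Real.dist_eq] at h1
    calc _ ≤ K * (‖z‖ - r) := h1
      _ ≤ K * (r * ((‖z‖ ^ 2 - r ^ 2) / r ^ 2)) := by gcongr
      _ ≤ _ := by nlinarith [mul_nonneg hM0 h4]
  · rw [min_eq_left ht.le, mul_one]
    have h1 := abs_le.1 (hM (x + z))
    have h2 := abs_le.1 (hM (x + r • ‖z‖⁻¹ • z))
    have : 0 ≤ K * r := by positivity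
    rw [abs_le]
    constructor <;> linarith [h1.1, h1.2, h2.1, h2.2]

/-- The normalization of the constant `cK` in terms of the area of the unit sphere. -/
theorem toSphere_real_univ_mul_cK {N : ℕ} (hN : 1 ≤ N) (s : ℝ) :
    (volume : Measure (EuclideanSpace ℝ (Fin N))).toSphere.real Set.univ * (cK N s / 2)
      = Real.sin (Real.pi * s) / Real.pi := by
  have : Nonempty (Fin N) := ⟨⟨0, hN⟩⟩
  have hN0 : (0 : ℝ) < N := by exact_mod_cast hN
  have hG : 0 < Real.Gamma ((N : ℝ) / 2) := Real.Gamma_pos_of_pos (by positivity)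
  have hp : 0 < Real.pi ^ ((N : ℝ) / 2) := Real.rpow_pos_of_pos Real.pi_pos _
  have hs : √Real.pi ^ N = Real.pi ^ ((N : ℝ) / 2) := by
    rw [Real.sqrt_eq_rpow, ← Real.rpow_natCast, ← Real.rpow_mul Real.pi_pos.le]
    ring_nf
  rw [Measure.toSphere_real_apply_univ, Measure.real, EuclideanSpace.volume_ball, cK,
    finrank_euclideanSpace, Fintype.card_fin, ENNReal.ofReal_one, one_pow, one_mul,
    Real.Gamma_add_one (by positivity), hs, ENNReal.toReal_ofReal (by positivity),
    Real.rpow_add Real.pi_pos, Real.rpow_one]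
  field_simp

/-- Comparison of the nonlocal mean value with a multiple of the spherical average; both the
multiple and the error are one-dimensional integrals. -/
theorem abs_integral_eta_mul_sub_le {N : ℕ} (hN : 2 ≤ N)
    {u : EuclideanSpace ℝ (Fin N) → ℝ} (hu : Continuous u)
    (hbdd : ∃ M : ℝ, ∀ x, |u x| ≤ M) (x : EuclideanSpace ℝ (Fin N)) {r : ℝ} (hr : 0 < r)
    {C : ℝ} (hC : ∀ z : EuclideanSpace ℝ (Fin N), r < ‖z‖ →
      |u (x + z) - u (x + r • ‖z‖⁻¹ • z)| ≤ C * min 1 ((‖z‖ ^ 2 - r ^ 2) / r ^ 2))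
    {s : ℝ} (hs : s ∈ Set.Ioo (0 : ℝ) 1) :
    |(∫ y in (Metric.ball x r)ᶜ, eta N s r (y - x) * u y)
        - (Real.sin (Real.pi * s) / Real.pi * ∫ t in Set.Ioi (0 : ℝ), t ^ (-s) / (1 + t))
          * ((∫ θ : Metric.sphere (0 : EuclideanSpace ℝ (Fin N)) 1,
              u (x + r • (θ : EuclideanSpace ℝ (Fin N)))
              ∂(volume : Measure (EuclideanSpace ℝ (Fin N))).toSphere)
            / (volume : Measure (EuclideanSpace ℝ (Fin N))).toSphere.real Set.univ)|
      ≤ C * (Real.sin (Real.pi * s) / Real.pi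
        * ∫ t in Set.Ioi (0 : ℝ), t ^ (-s) / (1 + t) * min 1 t) := by
  have hN1 : 1 ≤ N := by omega
  have : Nonempty (Fin N) := ⟨⟨0, hN1⟩⟩
  obtain ⟨M, hM⟩ := hbdd
  set σ := (volume : Measure (EuclideanSpace ℝ (Fin N))).toSphere with hσ
  obtain ⟨i1, i2, -⟩ := rpow_neg_div_one_add_bounds hs
  have hmass := toSphere_real_univ_mul_cK hN1 s
  rw [← hσ] at hmass
  have hσ0 : σ.real Set.univ ≠ 0 := by
    rw [ne_eq, measureReal_eq_zero_iff, Measure.measure_univ_eq_zero]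
    exact Measure.toSphere_ne_zero volume
  set g : ℝ → ℝ := fun y =>
    if r < y then cK N s * r ^ (2 * s) / (y ^ N * (y ^ 2 - r ^ 2) ^ s) else 0 with hg
  have heta : ∀ z, eta N s r z = g ‖z‖ := fun z => rfl
  have hc0 : 0 ≤ cK N s := by
    have : 0 ≤ Real.sin (Real.pi * s) := Real.sin_nonneg_of_nonneg_of_le_pi
      (mul_nonneg Real.pi_pos.le hs.1.le) (mul_le_of_le_one_right Real.pi_pos.le hs.2.le)
    have : 0 < Real.Gamma ((N : ℝ) / 2) := Real.Gamma_pos_of_pos (by positivity)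
    unfold cK
    positivity
  have hg0 : ∀ y, 0 ≤ g y := by
    intro y
    simp only [hg]
    split_ifs with h
    · have : 0 < y ^ 2 - r ^ 2 := by nlinarith
      have : 0 < y := hr.trans h
      positivity
    · rfl
  have hgint : Integrable fun z : EuclideanSpace ℝ (Fin N) => g ‖z‖ := by
    rw [integrable_fun_norm_addHaar volume, finrank_euclideanSpace, Fintype.card_fin]
    simpa only [smul_eq_mul, mul_one, hg] using
      integrableOn_Ioi_radial_kernel hN1 (cK N s) hr (fun _ => 1) (s := s) (by simpa using i1)
  have hgint' : Integrable fun z : EuclideanSpace ℝ (Fin N) =>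
      g ‖z‖ * min 1 ((‖z‖ ^ 2 - r ^ 2) / r ^ 2) := by
    rw [integrable_fun_norm_addHaar volume
      (f := fun y => g y * min 1 ((y ^ 2 - r ^ 2) / r ^ 2)), finrank_euclideanSpace,
      Fintype.card_fin]
    exact integrableOn_Ioi_radial_kernel hN1 (cK N s) hr (fun t => min 1 t) i2
  have hI1 : ∫ z : EuclideanSpace ℝ (Fin N), g ‖z‖ * u (x + r • ‖z‖⁻¹ • z)
      = (Real.sin (Real.pi * s) / Real.pi * ∫ t in Set.Ioi (0 : ℝ), t ^ (-s) / (1 + t))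
        * ((∫ θ : Metric.sphere (0 : EuclideanSpace ℝ (Fin N)) 1,
          u (x + r • (θ : EuclideanSpace ℝ (Fin N))) ∂σ) / σ.real Set.univ) := by
    have h := setIntegral_Ioi_radial_kernel hN1 (cK N s) hr (fun _ => 1) (s := s)
    simp only [mul_one] at h
    rw [integral_fun_norm_mul_fun_direction volume g (fun w => u (x + r • w)),
      finrank_euclideanSpace, Fintype.card_fin, h, ← hmass, ← hσ]
    field_simp
  have hI2 : ∫ z : EuclideanSpace ℝ (Fin N), g ‖z‖ * min 1 ((‖z‖ ^ 2 - r ^ 2) / r ^ 2)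
      = Real.sin (Real.pi * s) / Real.pi
        * ∫ t in Set.Ioi (0 : ℝ), t ^ (-s) / (1 + t) * min 1 t := by
    have h := integral_fun_norm_mul_fun_direction (volume : Measure (EuclideanSpace ℝ (Fin N)))
      (fun y => g y * min 1 ((y ^ 2 - r ^ 2) / r ^ 2)) (fun _ => 1)
    simp only [mul_one, integral_const, smul_eq_mul] at h
    rw [h, finrank_euclideanSpace, Fintype.card_fin,
      setIntegral_Ioi_radial_kernel hN1 (cK N s) hr (fun t => min 1 t), ← hmass]
    ring
  have hI : ∫ y in (Metric.ball x r)ᶜ, eta N s r (y - x) * u y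
      = ∫ z : EuclideanSpace ℝ (Fin N), g ‖z‖ * u (x + z) := by
    rw [setIntegral_eq_integral_of_forall_compl_eq_zero,
      ← integral_sub_right_eq_self (fun z => g ‖z‖ * u (x + z)) x]
    · simp [heta]
    · intro y hy
      have : ‖y - x‖ < r := by simpa [dist_eq_norm] using hy
      simp [heta, hg, this.le.not_gt]
  have hJ1 : Integrable fun z : EuclideanSpace ℝ (Fin N) => g ‖z‖ * u (x + z) :=
    hgint.mul_bdd (c := M) (by fun_prop) (.of_forall fun z => hM _)
  have hJ2 : Integrable fun z : EuclideanSpace ℝ (Fin N) => g ‖z‖ * u (x + r • ‖z‖⁻¹ • z) := by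
    refine hgint.mul_bdd (c := M) (Measurable.aestronglyMeasurable ?_) (.of_forall fun z => hM _)
    exact hu.measurable.comp (by fun_prop)
  rw [hI, ← hI1, ← integral_sub hJ1 hJ2, ← hI2, ← integral_const_mul, ← Real.norm_eq_abs]
  refine norm_integral_le_of_norm_le (hgint'.const_mul C) (.of_forall fun z => ?_)
  rw [← mul_sub, norm_mul, Real.norm_of_nonneg (hg0 _), mul_left_comm]
  by_cases hz : r < ‖z‖
  · exact mul_le_mul_of_nonneg_left (hC z hz) (hg0 _)
  · simp [hg, hz]

/-- **Asymptotics of the nonlocal mean value kernel as `s ↑ 1`**: for a bounded `C²` function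
`u`, the nonlocal mean value `∫_{ℝ^N∖B_r(x)} η_r^{(s)}(y−x)·u(y) dy` converges, as `s ↑ 1`,
to the classical spherical average `(1/(ω_{N−1}·r^{N−1}))·∫_{∂B_r(x)} u dH^{N−1}`,
where `ω_{N−1} = H^{N−1}(S^{N−1})`. -/
theorem eta_mean_value_asymptotics (N : ℕ) (hN : 2 ≤ N)
    (u : EuclideanSpace ℝ (Fin N) → ℝ) (hu : ContDiff ℝ 2 u)
    (hbdd : ∃ M : ℝ, ∀ x, |u x| ≤ M)
    (x : EuclideanSpace ℝ (Fin N)) (r : ℝ) (hr : 0 < r) :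
    Tendsto (fun s : ℝ => ∫ y in (Metric.ball x r)ᶜ, eta N s r (y - x) * u y)
      (nhdsWithin 1 (Set.Ioo 0 1))
      (nhds ((1 / ((μH[(N : ℝ) - 1] (Metric.sphere (0 : EuclideanSpace ℝ (Fin N)) 1)).toReal *
          r ^ (N - 1))) * ∫ y in Metric.sphere x r, u y ∂μH[(N : ℝ) - 1])) := by
  have hcast : (N : ℝ) - 1 = ((N - 1 : ℕ) : ℝ) := by
    rw [Nat.cast_sub (by omega), Nat.cast_one]
  have hdim : Module.finrank ℝ (EuclideanSpace ℝ (Fin N)) = N - 1 + 1 := by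
    rw [finrank_euclideanSpace, Fintype.card_fin]
    omega
  have havg := toSphere_average_eq_hausdorffMeasure_average hdim volume
    (fun A => A.measurePreserving) (f := fun θ => u (x + r • (θ : EuclideanSpace ℝ (Fin N))))
    (by have := hu.continuous; fun_prop)
  have hlim : (1 / ((μH[(N : ℝ) - 1] (Metric.sphere (0 : EuclideanSpace ℝ (Fin N)) 1)).toReal *
      r ^ (N - 1))) * ∫ y in Metric.sphere x r, u y ∂μH[(N : ℝ) - 1]
      = (∫ θ : Metric.sphere (0 : EuclideanSpace ℝ (Fin N)) 1,
          u (x + r • (θ : EuclideanSpace ℝ (Fin N)))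
            ∂(volume : Measure (EuclideanSpace ℝ (Fin N))).toSphere)
        / (volume : Measure (EuclideanSpace ℝ (Fin N))).toSphere.real Set.univ := by
    rw [havg, hcast, setIntegral_sphere_hausdorffMeasure _ u x hr]
    field_simp
  rw [hlim]
  obtain ⟨C, hC⟩ := exists_abs_sub_radial_projection_le (hu.of_le one_le_two) hbdd x hr
  obtain ⟨t1, t2⟩ := tendsto_sin_mul_integral_rpow_neg_div_one_add
  have hdiff := squeeze_zero_norm' (eventually_mem_nhdsWithin.mono fun s hs =>
    (Real.norm_eq_abs _).trans_le
      (abs_integral_eta_mul_sub_le hN hu.continuous hbdd x hr hC hs))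
    (by simpa only [mul_zero] using t2.const_mul C)
  have hadd := fun L => hdiff.add (t1.mul_const L)
  simp only [zero_add, one_mul] at hadd
  exact (hadd _).congr fun s => sub_add_cancel _ _
end

section
/- Existence and finiteness of nonlocal curvatures: for every e ∈ S^{N−2}, the principal value limit defining the nonlocal directional curvature K_{s,e} exists and is finite, and the principal value limit defining the nonlocal mean curvature H_s exists and is finite. -/
open MeasureTheory Filter

/-- `χ̃_E = χ_E − χ_{∁E}` for the subgraph `E = {(x′,h) : h ≤ f(x′)}`. -/
noncomputable def chiT {n : ℕ} (f : EuclideanSpace ℝ (Fin n) → ℝ)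
    (p : EuclideanSpace ℝ (Fin n) × ℝ) : ℝ :=
  if p.2 ≤ f p.1 then 1 else -1

/-- The truncated integral `∫₀^{+∞} dρ ∫_ℝ dh χ_{ρ²+h²≥ε²}·ρ^{N−2}·χ̃_E(ρe+h·e_N)/(ρ²+h²)^{(N+2s)/2}`
whose limit as `ε ↓ 0` defines the nonlocal directional curvature. -/
noncomputable def dirInt (N : ℕ) (s : ℝ) (f : EuclideanSpace ℝ (Fin (N - 1)) → ℝ)
    (e : EuclideanSpace ℝ (Fin (N - 1))) (ε : ℝ) : ℝ :=
  ∫ ρ in Set.Ioi (0 : ℝ), ∫ h : ℝ,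
    if ε ^ 2 ≤ ρ ^ 2 + h ^ 2 then
      ρ ^ (N - 2) * chiT f (ρ • e, h) / (ρ ^ 2 + h ^ 2) ^ (((N : ℝ) + 2 * s) / 2)
    else 0

/-- The nonlocal directional curvature of `∂E` at `0` in direction `e` equals `K`
(as a principal value). -/
def HasDirCurv (N : ℕ) (s : ℝ) (f : EuclideanSpace ℝ (Fin (N - 1)) → ℝ)
    (e : EuclideanSpace ℝ (Fin (N - 1))) (K : ℝ) : Prop :=
  Tendsto (dirInt N s f e) (nhdsWithin 0 (Set.Ioi 0)) (nhds K)

/-- The truncated integral `∫_{ℝ^N∖B_ε} χ̃_E(x)/|x|^{N+2s} dx`, written in the coordinates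
`x = (x′,h) ∈ ℝ^{N−1}×ℝ` (so `|x|² = ‖x′‖²+h²`). -/
noncomputable def meanInt (N : ℕ) (s : ℝ) (f : EuclideanSpace ℝ (Fin (N - 1)) → ℝ)
    (ε : ℝ) : ℝ :=
  ∫ p in {p : EuclideanSpace ℝ (Fin (N - 1)) × ℝ | ε ^ 2 ≤ ‖p.1‖ ^ 2 + p.2 ^ 2},
    chiT f p / (‖p.1‖ ^ 2 + p.2 ^ 2) ^ (((N : ℝ) + 2 * s) / 2)

/-- `ω_{N−2} = H^{N−2}(S^{N−2})`, the Hausdorff measure of the unit sphere of `ℝ^{N−1}`. -/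
noncomputable def omegaS (N : ℕ) : ℝ :=
  (μH[(N : ℝ) - 2] (Metric.sphere (0 : EuclideanSpace ℝ (Fin (N - 1))) 1)).toReal

/-- The nonlocal mean curvature of `∂E` at `0` equals `H` (as a principal value). -/
def HasMeanCurv (N : ℕ) (s : ℝ) (f : EuclideanSpace ℝ (Fin (N - 1)) → ℝ) (H : ℝ) : Prop :=
  Tendsto (fun ε => (1 / omegaS N) * meanInt N s f ε) (nhdsWithin 0 (Set.Ioi 0)) (nhds H)

/-- The integral over `X × ℝ` of a function odd in the second variable vanishes. -/
theorem integral_prod_eq_zero_of_odd {X : Type*} [MeasurableSpace X] (μ : Measure X) [SFinite μ]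
    {g : X × ℝ → ℝ} (hg : ∀ p, g (p.1, -p.2) = -g p) :
    ∫ p, g p ∂(μ.prod volume) = 0 := by
  have hmp : MeasurePreserving (Prod.map id (fun h : ℝ => -h)) (μ.prod volume)
      (μ.prod volume) :=
    (MeasurePreserving.id μ).prod (Measure.measurePreserving_neg volume)
  have hemb : MeasurableEmbedding (Prod.map id (fun h : ℝ => -h) : X × ℝ → X × ℝ) :=
    ((MeasurableEquiv.refl X).prodCongr (MeasurableEquiv.neg ℝ)).measurableEmbedding
  have h := hmp.integral_comp hemb g
  simp only [Prod.map, id, hg, integral_neg] at h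
  linarith

/-- A function vanishing to first order at the origin is quadratically small there. -/
theorem exists_abs_le_mul_norm_sq_of_fderiv_eq_zero {F : Type*} [NormedAddCommGroup F]
    [NormedSpace ℝ F] {f : F → ℝ} (hf : ContDiff ℝ 2 f) (hf0 : f 0 = 0)
    (hdf : fderiv ℝ f 0 = 0) :
    ∃ C δ : ℝ, 0 < C ∧ 0 < δ ∧ ∀ x, ‖x‖ < δ → |f x| ≤ C * ‖x‖ ^ 2 := by
  have h1 : ContDiff ℝ 1 (fderiv ℝ f) := hf.fderiv_right (by norm_num)
  have h2 := ((h1.differentiable (by norm_num)) 0).isBigO_sub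
  simp only [hdf, sub_zero] at h2
  obtain ⟨C, hC, hO⟩ := h2.exists_pos
  rw [Asymptotics.isBigOWith_iff, Metric.eventually_nhds_iff] at hO
  obtain ⟨δ, hδ, hb⟩ := hO
  refine ⟨C, δ, hC, hδ, fun x hx => ?_⟩
  have := (convex_closedBall (0 : F) ‖x‖).norm_image_sub_le_of_norm_fderiv_le (𝕜 := ℝ) (f := f)
    (C := C * ‖x‖) (x := 0) (y := x) (fun y _ => (hf.differentiable (by norm_num)) y)
    (fun y hy => ?_) (by simp) (by simp)
  · simpa [hf0, pow_two, mul_assoc] using this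
  · have hy' : ‖y‖ ≤ ‖x‖ := by simpa using hy
    exact (hb (by simpa using hy'.trans_lt hx)).trans (by gcongr)

section PrincipalValue

variable {E : Type*} [NormedAddCommGroup E] [NormedSpace ℝ E] [FiniteDimensional ℝ E]
  [MeasurableSpace E] [BorelSpace E] (μ : Measure E) [μ.IsAddHaarMeasure]

/-- The kernel `(‖x‖² + h²)^(-b/2)` is integrable away from the origin of `E × ℝ` when `b`
exceeds the dimension. -/
theorem integrable_rpow_norm_sq_add_sq_outside_ball {b : ℝ}
    (hb : (Module.finrank ℝ E : ℝ) + 1 < b) {ε : ℝ} (hε : 0 < ε) :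
    Integrable (fun p : E × ℝ => if ε ^ 2 ≤ ‖p.1‖ ^ 2 + p.2 ^ 2 then
      (‖p.1‖ ^ 2 + p.2 ^ 2) ^ (-b / 2) else 0) (μ.prod volume) := by
  have hb0 : 0 < b := by
    have : (0 : ℝ) ≤ Module.finrank ℝ E := Nat.cast_nonneg _
    linarith
  have hint : Integrable (fun p : E × ℝ => ((1 : ℝ) + ‖p‖ ^ 2) ^ (-b / 2)) (μ.prod volume) :=
    integrable_rpow_neg_one_add_norm_sq (by simpa using hb)
  refine (hint.const_mul ((1 / ε ^ 2 + 1) ^ (b / 2))).mono' ?_ (Eventually.of_forall fun p => ?_)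
  · refine (Measurable.ite ?_ (by fun_prop) measurable_const).aestronglyMeasurable
    exact measurableSet_le (by fun_prop) (by fun_prop)
  · split_ifs with hp
    · have hq : 0 < ‖p.1‖ ^ 2 + p.2 ^ 2 := lt_of_lt_of_le (by positivity) hp
      rw [Real.norm_of_nonneg (by positivity)]
      have hmax : ‖p‖ ^ 2 ≤ ‖p.1‖ ^ 2 + p.2 ^ 2 := by
        rw [Prod.norm_def]
        rcases max_choice ‖p.1‖ ‖p.2‖ with h | h <;> rw [h]
        · nlinarith [sq_nonneg p.2]
        · rw [Real.norm_eq_abs, sq_abs]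
          nlinarith [sq_nonneg ‖p.1‖]
      have hle : 1 + ‖p‖ ^ 2 ≤ (1 / ε ^ 2 + 1) * (‖p.1‖ ^ 2 + p.2 ^ 2) := by
        have : 1 ≤ 1 / ε ^ 2 * (‖p.1‖ ^ 2 + p.2 ^ 2) := by
          rw [one_div, inv_mul_eq_div, le_div_iff₀ (by positivity)]
          linarith
        linarith
      have hpow := Real.rpow_le_rpow_of_nonpos (z := -b / 2) (by positivity) hle (by linarith)
      rw [Real.mul_rpow (by positivity) hq.le] at hpow
      calc (‖p.1‖ ^ 2 + p.2 ^ 2) ^ (-b / 2)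
          = (1 / ε ^ 2 + 1) ^ (b / 2) *
            ((1 / ε ^ 2 + 1) ^ (-b / 2) * (‖p.1‖ ^ 2 + p.2 ^ 2) ^ (-b / 2)) := by
            rw [← mul_assoc, ← Real.rpow_add (by positivity)]
            simp [neg_div]
        _ ≤ _ := by gcongr
    · rw [norm_zero]
      positivity

/-- Between two paraboloids touching at the origin, `‖x‖^(-b)` is integrable near the origin
when `b` is less than the dimension plus one. -/
theorem integrable_rpow_norm_between_paraboloids [Nontrivial E] {b : ℝ}
    (hb : b < (Module.finrank ℝ E : ℝ) + 2) {C δ : ℝ} (hC : 0 < C) (hδ : 0 < δ) :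
    Integrable (fun p : E × ℝ => if ‖p.1‖ < δ ∧ |p.2| ≤ C * ‖p.1‖ ^ 2 then
      ‖p.1‖ ^ (-b) else 0) (μ.prod volume) := by
  have hslice : ∀ x : E, (fun h : ℝ => if ‖x‖ < δ ∧ |h| ≤ C * ‖x‖ ^ 2 then ‖x‖ ^ (-b) else 0) =
      (Set.Icc (-(C * ‖x‖ ^ 2)) (C * ‖x‖ ^ 2)).indicator
        (fun _ => if ‖x‖ < δ then ‖x‖ ^ (-b) else 0) := by
    intro x
    ext h
    by_cases h1 : ‖x‖ < δ <;> simp [Set.indicator_apply, abs_le, h1]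
  rw [integrable_prod_iff]
  · constructor
    · refine Eventually.of_forall fun x => ?_
      simp only [hslice]
      exact (integrable_indicator_iff measurableSet_Icc).2 (integrableOn_const (by simp))
    · have hnorm : (fun x : E => ∫ h : ℝ, ‖if ‖x‖ < δ ∧ |h| ≤ C * ‖x‖ ^ 2 then
          ‖x‖ ^ (-b) else 0‖) = fun x => (fun r : ℝ => 2 * C *
            (if r < δ then r ^ 2 * r ^ (-b) else 0)) ‖x‖ := by
        ext x
        have : ∀ h : ℝ, ‖if ‖x‖ < δ ∧ |h| ≤ C * ‖x‖ ^ 2 then ‖x‖ ^ (-b) else 0‖ =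
            if ‖x‖ < δ ∧ |h| ≤ C * ‖x‖ ^ 2 then ‖x‖ ^ (-b) else 0 := fun h =>
          Real.norm_of_nonneg (by split_ifs <;> positivity)
        simp only [this, hslice]
        rw [integral_indicator measurableSet_Icc, setIntegral_const]
        have hpos : 0 ≤ C * ‖x‖ ^ 2 := by positivity
        rw [Real.volume_real_Icc_of_le (by linarith), smul_eq_mul]
        split_ifs <;> ring
      simp only at hnorm ⊢
      rw [hnorm, integrable_fun_norm_addHaar μ
        (f := fun r : ℝ => 2 * C * (if r < δ then r ^ 2 * r ^ (-b) else 0))]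
      have hn : 1 ≤ Module.finrank ℝ E := Module.finrank_pos
      have hpow : IntegrableOn (fun r : ℝ => r ^ ((Module.finrank ℝ E : ℝ) + 1 - b))
          (Set.Ioo 0 δ) :=
        (intervalIntegral.integrableOn_Ioo_rpow_iff hδ).2 (by linarith)
      have h2 : IntegrableOn (fun r : ℝ => (Set.Ioo 0 δ).indicator
          (fun r => 2 * C * r ^ ((Module.finrank ℝ E : ℝ) + 1 - b)) r) (Set.Ioi 0) :=
        ((integrable_indicator_iff measurableSet_Ioo).2 (hpow.const_mul _)).integrableOn
      refine h2.congr_fun (fun r hr => ?_) measurableSet_Ioi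
      have hr : 0 < r := hr
      by_cases hrδ : r < δ
      · simp only [Set.indicator_apply, Set.mem_Ioo, hr, hrδ, and_self, if_true, smul_eq_mul]
        rw [← Real.rpow_natCast, ← Real.rpow_natCast, ← Real.rpow_add hr, mul_left_comm,
          ← Real.rpow_add hr, Nat.cast_sub hn]
        congr 2
        push_cast
        ring
      · simp [hrδ]
  · refine (Measurable.ite ?_ (by fun_prop) measurable_const).aestronglyMeasurable
    exact (measurableSet_lt (f := fun p : E × ℝ => ‖p.1‖) (g := fun _ => δ)
        (by fun_prop) (by fun_prop)).inter
      (measurableSet_le (f := fun p : E × ℝ => |p.2|) (g := fun p => C * ‖p.1‖ ^ 2)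
        (by fun_prop) (by fun_prop))

/-- Truncated integrability of a bounded density against a kernel dominated by
`(‖x‖² + h²)^(-b/2)`. -/
theorem integrable_truncated_mul {b : ℝ} (hb : (Module.finrank ℝ E : ℝ) + 1 < b)
    {K χ : E × ℝ → ℝ} (hKm : Measurable K)
    (hK : ∀ p, |K p| ≤ (‖p.1‖ ^ 2 + p.2 ^ 2) ^ (-b / 2))
    (hχm : Measurable χ) (hχ : ∀ p, |χ p| ≤ 1) {ε : ℝ} (hε : 0 < ε) :
    Integrable (fun p : E × ℝ => if ε ^ 2 ≤ ‖p.1‖ ^ 2 + p.2 ^ 2 then χ p * K p else 0)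
      (μ.prod volume) := by
  refine (integrable_rpow_norm_sq_add_sq_outside_ball μ hb hε).mono' ?_
    (Eventually.of_forall fun p => ?_)
  · refine (Measurable.ite ?_ (by fun_prop) measurable_const).aestronglyMeasurable
    exact measurableSet_le (by fun_prop) (by fun_prop)
  · split_ifs
    · rw [Real.norm_eq_abs, abs_mul]
      exact (mul_le_of_le_one_left (abs_nonneg _) (hχ p)).trans (hK p)
    · simp

/-- If `χ` agrees with `-sign h` off the region between two paraboloids touching at the origin,
then the integral of `χ` against an even singular kernel of order `b` converges as a
principal value. -/
theorem exists_tendsto_integral_truncated [Nontrivial E] {b : ℝ}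
    (hb : (Module.finrank ℝ E : ℝ) + 1 < b) (hb' : b < (Module.finrank ℝ E : ℝ) + 2)
    {K χ : E × ℝ → ℝ} (hKm : Measurable K)
    (hK : ∀ p, |K p| ≤ (‖p.1‖ ^ 2 + p.2 ^ 2) ^ (-b / 2))
    (hKeven : ∀ p : E × ℝ, K (p.1, -p.2) = K p)
    (hχm : Measurable χ) (hχ : ∀ p, |χ p| ≤ 1) {C δ : ℝ} (hC : 0 < C) (hδ : 0 < δ)
    (hχsign : ∀ p : E × ℝ, ‖p.1‖ < δ → C * ‖p.1‖ ^ 2 < |p.2| → χ p = -Real.sign p.2) :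
    ∃ L : ℝ, Tendsto (fun ε : ℝ => ∫ p : E × ℝ,
      (if ε ^ 2 ≤ ‖p.1‖ ^ 2 + p.2 ^ 2 then χ p * K p else 0) ∂(μ.prod volume))
      (nhdsWithin 0 (Set.Ioi 0)) (nhds L) := by
  have hb0 : 0 < b := by
    have : (0 : ℝ) ≤ Module.finrank ℝ E := Nat.cast_nonneg _
    linarith
  have hsm : Measurable (fun p : E × ℝ => Real.sign p.2) := by
    unfold Real.sign
    refine Measurable.ite (measurableSet_lt (by fun_prop) (by fun_prop)) (by fun_prop)
      (Measurable.ite (measurableSet_lt (by fun_prop) (by fun_prop)) (by fun_prop) (by fun_prop))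
  have hs : ∀ p : E × ℝ, |Real.sign p.2| ≤ 1 := by
    intro p
    rcases Real.sign_apply_eq p.2 with h | h | h <;> simp [h]
  set D : E × ℝ → ℝ := fun p => χ p + Real.sign p.2 with hD
  have hDm : Measurable D := hχm.add hsm
  have hD2 : ∀ p, |D p| ≤ 2 := fun p => by
    have := abs_add_le (χ p) (Real.sign p.2)
    have h1 := hχ p
    have h2 := hs p
    simp only [hD]
    linarith
  have hsplit : ∀ ε : ℝ, 0 < ε → ∫ p : E × ℝ,
      (if ε ^ 2 ≤ ‖p.1‖ ^ 2 + p.2 ^ 2 then χ p * K p else 0) ∂(μ.prod volume) =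
      ∫ p : E × ℝ, (if ε ^ 2 ≤ ‖p.1‖ ^ 2 + p.2 ^ 2 then D p * K p else 0)
        ∂(μ.prod volume) := by
    intro ε hε
    have hodd : ∫ p : E × ℝ, (if ε ^ 2 ≤ ‖p.1‖ ^ 2 + p.2 ^ 2 then Real.sign p.2 * K p else 0)
        ∂(μ.prod volume) = 0 := by
      refine integral_prod_eq_zero_of_odd μ fun p => ?_
      simp only [neg_sq, hKeven]
      split_ifs
      · rw [Real.sign_neg]
        ring
      · simp
    refine (add_zero _).symm.trans ?_
    refine (congrArg _ hodd.symm).trans ?_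
    rw [← integral_add (integrable_truncated_mul μ hb hKm hK hχm hχ hε)
        (integrable_truncated_mul μ hb hKm hK hsm hs hε)]
    refine integral_congr_ae (Eventually.of_forall fun p => ?_)
    simp only [hD]
    split_ifs <;> ring
  have hbound : ∀ p, |D p * K p| ≤
      2 * (if δ ^ 2 ≤ ‖p.1‖ ^ 2 + p.2 ^ 2 then (‖p.1‖ ^ 2 + p.2 ^ 2) ^ (-b / 2) else 0) +
      2 * (if ‖p.1‖ < δ ∧ |p.2| ≤ C * ‖p.1‖ ^ 2 then ‖p.1‖ ^ (-b) else 0) := by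
    intro p
    have hDK : |D p * K p| ≤ 2 * (‖p.1‖ ^ 2 + p.2 ^ 2) ^ (-b / 2) := by
      rw [abs_mul]
      exact mul_le_mul (hD2 p) (hK p) (abs_nonneg _) (by norm_num)
    have hA : 0 ≤ (if δ ^ 2 ≤ ‖p.1‖ ^ 2 + p.2 ^ 2 then
        (‖p.1‖ ^ 2 + p.2 ^ 2) ^ (-b / 2) else 0 : ℝ) := by split_ifs <;> positivity
    have hB : 0 ≤ (if ‖p.1‖ < δ ∧ |p.2| ≤ C * ‖p.1‖ ^ 2 then ‖p.1‖ ^ (-b) else 0 : ℝ) := by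
      split_ifs <;> positivity
    rcases le_or_gt δ ‖p.1‖ with h1 | h1
    · have : δ ^ 2 ≤ ‖p.1‖ ^ 2 + p.2 ^ 2 := by nlinarith [sq_nonneg p.2]
      rw [if_pos this]
      linarith
    · rcases le_or_gt |p.2| (C * ‖p.1‖ ^ 2) with h2 | h2
      · rw [if_pos (And.intro h1 h2)]
        have : (‖p.1‖ ^ 2 + p.2 ^ 2) ^ (-b / 2) ≤ ‖p.1‖ ^ (-b) := by
          rcases eq_or_ne ‖p.1‖ 0 with h0 | h0
          · have h3 : p.2 = 0 := by simpa [h0] using h2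
            simp [h0, h3, Real.zero_rpow (neg_ne_zero.2 hb0.ne'),
              Real.zero_rpow (div_ne_zero (neg_ne_zero.2 hb0.ne') two_ne_zero)]
          · have h4 : 0 < ‖p.1‖ := lt_of_le_of_ne (norm_nonneg _) h0.symm
            calc (‖p.1‖ ^ 2 + p.2 ^ 2) ^ (-b / 2) ≤ (‖p.1‖ ^ 2) ^ (-b / 2) :=
                  Real.rpow_le_rpow_of_nonpos (by positivity)
                    (le_add_of_nonneg_right (sq_nonneg _)) (by linarith)
              _ = ‖p.1‖ ^ (-b) := by
                  rw [← Real.rpow_natCast, ← Real.rpow_mul h4.le]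
                  congr 1
                  push_cast
                  ring
        linarith
      · have : D p = 0 := by simp [hD, hχsign p h1 h2]
        rw [this, zero_mul, abs_zero]
        linarith
  refine ⟨∫ p, D p * K p ∂(μ.prod volume), ?_⟩
  refine Tendsto.congr' (f₁ := fun ε : ℝ => ∫ p : E × ℝ,
    (if ε ^ 2 ≤ ‖p.1‖ ^ 2 + p.2 ^ 2 then D p * K p else 0) ∂(μ.prod volume)) ?_ ?_
  · filter_upwards [self_mem_nhdsWithin] with ε hε using (hsplit ε hε).symm
  · refine tendsto_integral_filter_of_dominated_convergence _ (Eventually.of_forall fun ε => ?_)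
      (Eventually.of_forall fun ε => Eventually.of_forall fun p => ?_)
      (((integrable_rpow_norm_sq_add_sq_outside_ball μ hb hδ).const_mul 2).add
        ((integrable_rpow_norm_between_paraboloids μ hb' hC hδ).const_mul 2))
      (Eventually.of_forall fun p => ?_)
    · refine (Measurable.ite ?_ (by fun_prop) measurable_const).aestronglyMeasurable
      exact measurableSet_le (by fun_prop) (by fun_prop)
    · refine le_trans ?_ (hbound p)
      split_ifs
      · exact le_rfl
      · rw [norm_zero]
        exact abs_nonneg _
    · rcases eq_or_ne (‖p.1‖ ^ 2 + p.2 ^ 2) 0 with h0 | h0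
      · have hKp : K p = 0 := by
          have := hK p
          rw [h0, Real.zero_rpow (div_ne_zero (neg_ne_zero.2 hb0.ne') two_ne_zero)] at this
          exact abs_nonpos_iff.1 this
        simp [hKp]
      · have hpos : 0 < ‖p.1‖ ^ 2 + p.2 ^ 2 := lt_of_le_of_ne (by positivity) h0.symm
        have hev : ∀ᶠ ε : ℝ in nhdsWithin 0 (Set.Ioi 0), ε ^ 2 < ‖p.1‖ ^ 2 + p.2 ^ 2 := by
          refine nhdsWithin_le_nhds ?_
          have hc : Tendsto (fun ε : ℝ => ε ^ 2) (nhds 0) (nhds 0) := by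
            simpa using (continuous_pow 2 : Continuous fun ε : ℝ => ε ^ 2).tendsto 0
          exact hc.eventually_lt_const hpos
        refine tendsto_const_nhds.congr' ?_
        filter_upwards [hev] with ε hε
        rw [if_pos hε.le]

end PrincipalValue

theorem abs_chiT {n : ℕ} (f : EuclideanSpace ℝ (Fin n) → ℝ)
    (p : EuclideanSpace ℝ (Fin n) × ℝ) : |chiT f p| = 1 := by
  unfold chiT
  split_ifs <;> simp

theorem measurable_chiT {n : ℕ} {f : EuclideanSpace ℝ (Fin n) → ℝ} (hf : Measurable f) :
    Measurable (chiT f) :=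
  Measurable.ite (measurableSet_le measurable_snd (hf.comp measurable_fst)) measurable_const
    measurable_const

theorem chiT_eq_neg_sign {n : ℕ} {f : EuclideanSpace ℝ (Fin n) → ℝ}
    {p : EuclideanSpace ℝ (Fin n) × ℝ} (hp : |f p.1| < |p.2|) :
    chiT f p = -Real.sign p.2 := by
  have h := neg_abs_le (f p.1)
  have h' := le_abs_self (f p.1)
  unfold chiT
  rcases lt_trichotomy p.2 0 with hneg | hzero | hpos
  · rw [abs_of_neg hneg] at hp
    rw [if_pos (by linarith), Real.sign_of_neg hneg, neg_neg]
  · rw [hzero, abs_zero] at hp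
    exact absurd hp (abs_nonneg _).not_gt
  · rw [abs_of_pos hpos] at hp
    rw [if_neg (by linarith), Real.sign_of_pos hpos]

theorem exists_hasMeanCurv {N : ℕ} (hN : 3 ≤ N) {s : ℝ} (hs : s ∈ Set.Ioo (0 : ℝ) (1 / 2))
    {f : EuclideanSpace ℝ (Fin (N - 1)) → ℝ} (hf : ContDiff ℝ 2 f)
    (hf0 : f 0 = 0) (hdf : fderiv ℝ f 0 = 0) : ∃ H : ℝ, HasMeanCurv N s f H := by
  obtain ⟨C, δ, hC, hδ, hfC⟩ := exists_abs_le_mul_norm_sq_of_fderiv_eq_zero hf hf0 hdf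
  have hfin : (Module.finrank ℝ (EuclideanSpace ℝ (Fin (N - 1))) : ℝ) = N - 1 := by
    rw [finrank_euclideanSpace_fin, Nat.cast_sub (by omega), Nat.cast_one]
  have : Nonempty (Fin (N - 1)) := ⟨⟨0, by omega⟩⟩
  obtain ⟨L, hL⟩ := exists_tendsto_integral_truncated
    (volume : Measure (EuclideanSpace ℝ (Fin (N - 1)))) (b := (N : ℝ) + 2 * s)
    (by rw [hfin]; linarith [hs.1]) (by rw [hfin]; linarith [hs.2])
    (K := fun p => (‖p.1‖ ^ 2 + p.2 ^ 2) ^ (-((N : ℝ) + 2 * s) / 2)) (χ := chiT f)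
    (by fun_prop) (fun p => (abs_of_nonneg (by positivity)).le) (fun p => by simp)
    (measurable_chiT hf.continuous.measurable) (fun p => (abs_chiT f p).le) hC hδ
    (fun p h1 h2 => chiT_eq_neg_sign ((hfC _ h1).trans_lt h2))
  refine ⟨1 / omegaS N * L, Tendsto.const_mul _ (hL.congr fun ε => ?_)⟩
  unfold meanInt
  rw [← integral_indicator (measurableSet_le (by fun_prop) (by fun_prop))]
  refine integral_congr_ae (Eventually.of_forall fun p => ?_)
  simp only [Set.indicator_apply, Set.mem_ofPred_eq]
  rw [neg_div, Real.rpow_neg (by positivity), ← div_eq_mul_inv]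

theorem exists_hasDirCurv {N : ℕ} (hN : 3 ≤ N) {s : ℝ} (hs : s ∈ Set.Ioo (0 : ℝ) (1 / 2))
    {f : EuclideanSpace ℝ (Fin (N - 1)) → ℝ} (hf : ContDiff ℝ 2 f)
    (hf0 : f 0 = 0) (hdf : fderiv ℝ f 0 = 0) {e : EuclideanSpace ℝ (Fin (N - 1))}
    (he : ‖e‖ = 1) : ∃ K : ℝ, HasDirCurv N s f e K := by
  obtain ⟨C, δ, hC, hδ, hfC⟩ := exists_abs_le_mul_norm_sq_of_fderiv_eq_zero hf hf0 hdf
  have hnorm : ∀ ρ : ℝ, ‖ρ • e‖ = ‖ρ‖ := fun ρ => by rw [norm_smul, he, mul_one]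
  let K : ℝ × ℝ → ℝ := fun p => if 0 < p.1 then
    p.1 ^ (N - 2) * (‖p.1‖ ^ 2 + p.2 ^ 2) ^ (-((N : ℝ) + 2 * s) / 2) else 0
  let χ : ℝ × ℝ → ℝ := fun p => chiT f (p.1 • e, p.2)
  have hKm : Measurable K :=
    Measurable.ite (measurableSet_lt (by fun_prop) (by fun_prop)) (by fun_prop) (by fun_prop)
  have hχm : Measurable χ := (measurable_chiT hf.continuous.measurable).comp (by fun_prop)
  have hχ : ∀ p, |χ p| ≤ 1 := fun p => (abs_chiT f _).le
  have hK : ∀ p, |K p| ≤ (‖p.1‖ ^ 2 + p.2 ^ 2) ^ (-(2 + 2 * s) / 2) := by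
    intro p
    simp only [K]
    split_ifs with hp
    · have hq : 0 < ‖p.1‖ ^ 2 + p.2 ^ 2 := by
        have : 0 < ‖p.1‖ := norm_pos_iff.2 hp.ne'
        positivity
      rw [abs_of_nonneg (by positivity)]
      have hpow : p.1 ^ (N - 2) ≤ (‖p.1‖ ^ 2 + p.2 ^ 2) ^ (((N : ℝ) - 2) / 2) := by
        calc p.1 ^ (N - 2) = (‖p.1‖ ^ 2) ^ (((N : ℝ) - 2) / 2) := by
              rw [Real.norm_of_nonneg hp.le, ← Real.rpow_natCast, ← Real.rpow_natCast,
                ← Real.rpow_mul hp.le, Nat.cast_sub (by omega)]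
              congr 1
              push_cast
              ring
          _ ≤ _ := Real.rpow_le_rpow (by positivity)
              (le_add_of_nonneg_right (sq_nonneg _)) (by
                have : (3 : ℝ) ≤ N := by exact_mod_cast hN
                linarith)
      calc _ ≤ (‖p.1‖ ^ 2 + p.2 ^ 2) ^ (((N : ℝ) - 2) / 2) *
            (‖p.1‖ ^ 2 + p.2 ^ 2) ^ (-((N : ℝ) + 2 * s) / 2) := by gcongr
        _ = _ := by
          rw [← Real.rpow_add hq]
          congr 1
          ring
    · rw [abs_zero]
      positivity
  have hb : (Module.finrank ℝ ℝ : ℝ) + 1 < 2 + 2 * s := by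
    rw [Module.finrank_self]
    push_cast
    linarith [hs.1]
  obtain ⟨L, hL⟩ := exists_tendsto_integral_truncated (volume : Measure ℝ) hb
    (by rw [Module.finrank_self]; push_cast; linarith [hs.2]) hKm hK
    (fun p => by simp [K]) hχm hχ hC hδ
    (fun p h1 h2 => chiT_eq_neg_sign (p := (p.1 • e, p.2))
      ((hfC _ (by rwa [hnorm])).trans_lt (by rwa [hnorm])))
  refine ⟨L, hL.congr' ?_⟩
  filter_upwards [self_mem_nhdsWithin] with ε hε
  rw [integral_prod _ (integrable_truncated_mul volume hb hKm hK hχm hχ hε)]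
  unfold dirInt
  rw [← integral_indicator measurableSet_Ioi]
  refine integral_congr_ae (Eventually.of_forall fun ρ => ?_)
  by_cases hρ : 0 < ρ
  · simp only [Set.indicator_apply, Set.mem_Ioi, hρ, if_true, K, χ]
    refine integral_congr_ae (Eventually.of_forall fun h => ?_)
    simp only [Real.norm_eq_abs, sq_abs]
    congr 1
    rw [neg_div, Real.rpow_neg (by positivity), div_eq_mul_inv]
    ring
  · simp [K, hρ]

/-- **Existence and finiteness of nonlocal curvatures**: for every direction `e ∈ S^{N−2}` the
principal value defining the nonlocal directional curvature exists and is finite, and the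
principal value defining the nonlocal mean curvature exists and is finite. -/
theorem nonlocal_curvatures_exist (N : ℕ) (hN : 3 ≤ N) (s : ℝ)
    (hs : s ∈ Set.Ioo (0 : ℝ) (1 / 2))
    (f : EuclideanSpace ℝ (Fin (N - 1)) → ℝ) (hf : ContDiff ℝ 2 f)
    (hf0 : f 0 = 0) (hdf : fderiv ℝ f 0 = 0) :
    (∀ e : EuclideanSpace ℝ (Fin (N - 1)), ‖e‖ = 1 → ∃ K : ℝ, HasDirCurv N s f e K) ∧
    (∃ H : ℝ, HasMeanCurv N s f H) := by
  exact ⟨fun e he => exists_hasDirCurv hN hs hf hf0 hdf he,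
    exists_hasMeanCurv hN hs hf hf0 hdf⟩
end

section
/- Asymptotics of the nonlocal directional curvature as s ↑ 1/2: for every e ∈ S^{N−2}, lim_{s↑1/2} (1−2s)·K_{s,e} = ⟨D²f(0)·e, e⟩, where D²f(0) is the Hessian matrix of f at the origin; i.e. the rescaled nonlocal directional curvature converges to the classical directional curvature K_e of ∂E at 0 in direction e. -/
open MeasureTheory Filter

open Set Topology

/-- The kernel `(ρ² + h²)^{-p}` truncated to the complement of the ball of radius `ε`. -/
noncomputable def truncKernel (p ε ρ h : ℝ) : ℝ :=
  if ε ^ 2 ≤ ρ ^ 2 + h ^ 2 then ((ρ ^ 2 + h ^ 2) ^ p)⁻¹ else 0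

lemma truncKernel_nonneg (p ε ρ h : ℝ) : 0 ≤ truncKernel p ε ρ h := by
  unfold truncKernel
  split_ifs <;> positivity

lemma truncKernel_neg (p ε ρ h : ℝ) : truncKernel p ε ρ (-h) = truncKernel p ε ρ h := by
  simp [truncKernel]

lemma measurable_truncKernel (p ε : ℝ) :
    Measurable fun x : ℝ × ℝ => truncKernel p ε x.1 x.2 := by
  unfold truncKernel
  exact Measurable.ite (measurableSet_le (by fun_prop) (by fun_prop)) (by fun_prop)
    measurable_const

lemma truncKernel_eq_of_le {p ε ρ : ℝ} (hε : 0 ≤ ε) (h : ε ≤ ρ) :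
    truncKernel p ε ρ = truncKernel p 0 ρ := by
  funext t
  have h1 : ε ^ 2 ≤ ρ ^ 2 + t ^ 2 := by nlinarith [sq_nonneg t]
  have h2 : (0 : ℝ) ^ 2 ≤ ρ ^ 2 + t ^ 2 := by nlinarith [sq_nonneg t, sq_nonneg ρ]
  rw [truncKernel, truncKernel, if_pos h1, if_pos h2]

lemma rpow_sq_add_sq {p ρ : ℝ} (hρ : 0 < ρ) (h : ℝ) :
    ((ρ ^ 2 + h ^ 2) ^ p)⁻¹ = ρ ^ (-(2 * p)) * ((1 + (h / ρ) ^ 2) ^ p)⁻¹ := by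
  have h1 : ρ ^ 2 + h ^ 2 = ρ ^ 2 * (1 + (h / ρ) ^ 2) := by field_simp
  rw [h1, Real.mul_rpow (by positivity) (by positivity), mul_inv, Real.rpow_neg hρ.le,
    Real.rpow_mul hρ.le, Real.rpow_two]

lemma truncKernel_zero {p ρ : ℝ} (hρ : 0 < ρ) (h : ℝ) :
    truncKernel p 0 ρ h = ρ ^ (-(2 * p)) * ((1 + (h / ρ) ^ 2) ^ p)⁻¹ := by
  have h2 : (0 : ℝ) ^ 2 ≤ ρ ^ 2 + h ^ 2 := by nlinarith [sq_nonneg h, sq_nonneg ρ]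
  rw [truncKernel, if_pos h2, rpow_sq_add_sq hρ]

lemma truncKernel_le {p ρ : ℝ} (hp : 1 ≤ p) (hρ : 0 < ρ) (ε h : ℝ) :
    truncKernel p ε ρ h ≤ ρ ^ (-(2 * p)) * (1 + (h / ρ) ^ 2)⁻¹ := by
  unfold truncKernel
  split_ifs
  · rw [rpow_sq_add_sq hρ]
    gcongr
    exact Real.self_le_rpow_of_one_le (by nlinarith [sq_nonneg (h / ρ)]) hp
  · positivity

lemma truncKernel_le_rpow {p ρ : ℝ} (hp : 1 ≤ p) (hρ : 0 < ρ) (ε h : ℝ) :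
    truncKernel p ε ρ h ≤ ρ ^ (-(2 * p)) := by
  refine (truncKernel_le hp hρ ε h).trans ?_
  exact mul_le_of_le_one_right (by positivity)
    (inv_le_one_of_one_le₀ (by nlinarith [sq_nonneg (h / ρ)]))

lemma integrable_truncKernel {p ρ : ℝ} (hp : 1 ≤ p) (hρ : 0 < ρ) (ε : ℝ) :
    Integrable (truncKernel p ε ρ) := by
  refine ((integrable_inv_one_add_sq.comp_div hρ.ne').const_mul (ρ ^ (-(2 * p)))).mono'
    ((measurable_truncKernel p ε).comp measurable_prodMk_left).aestronglyMeasurable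
    (ae_of_all _ fun h => ?_)
  rw [Real.norm_of_nonneg (truncKernel_nonneg ..)]
  exact truncKernel_le hp hρ ε h

lemma integral_truncKernel_le {p ρ : ℝ} (hp : 1 ≤ p) (hρ : 0 < ρ) (ε : ℝ) :
    ∫ h, truncKernel p ε ρ h ≤ Real.pi * ρ ^ (1 - 2 * p) := by
  calc ∫ h, truncKernel p ε ρ h
      ≤ ∫ h, ρ ^ (-(2 * p)) * (1 + (h / ρ) ^ 2)⁻¹ :=
        integral_mono (integrable_truncKernel hp hρ ε)
          ((integrable_inv_one_add_sq.comp_div hρ.ne').const_mul _)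
          (truncKernel_le hp hρ ε)
    _ = Real.pi * ρ ^ (1 - 2 * p) := by
        rw [integral_const_mul, Measure.integral_comp_div (fun x : ℝ => (1 + x ^ 2)⁻¹),
          integral_univ_inv_one_add_sq, sub_eq_add_neg, Real.rpow_add hρ, Real.rpow_one,
          abs_of_pos hρ, smul_eq_mul]
        ring

/-- The inner integral over `h` in the definition of `dirInt`. -/
noncomputable def dirSlice (N : ℕ) (s : ℝ) (f : EuclideanSpace ℝ (Fin (N - 1)) → ℝ)
    (e : EuclideanSpace ℝ (Fin (N - 1))) (ε ρ : ℝ) : ℝ :=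
  ∫ h : ℝ, if ε ^ 2 ≤ ρ ^ 2 + h ^ 2 then
      ρ ^ (N - 2) * chiT f (ρ • e, h) / (ρ ^ 2 + h ^ 2) ^ (((N : ℝ) + 2 * s) / 2)
    else 0

section Slice

variable {N : ℕ} {s : ℝ} {f : EuclideanSpace ℝ (Fin (N - 1)) → ℝ}
  {e : EuclideanSpace ℝ (Fin (N - 1))}

lemma dirSlice_eq_integral_truncKernel (ε ρ : ℝ) :
    dirSlice N s f e ε ρ = ρ ^ (N - 2) *
      ∫ h, chiT f (ρ • e, h) * truncKernel (((N : ℝ) + 2 * s) / 2) ε ρ h := by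
  rw [dirSlice, ← integral_const_mul]
  congr 1 with h
  unfold truncKernel
  split_ifs <;> ring

lemma stronglyMeasurable_dirSlice (hf : Continuous f) (ε : ℝ) :
    StronglyMeasurable (dirSlice N s f e ε) := by
  have hchi : Measurable fun x : ℝ × ℝ => chiT f (x.1 • e, x.2) := by
    unfold chiT
    exact Measurable.ite (measurableSet_le (by fun_prop)
      (by fun_prop)) measurable_const measurable_const
  have h : StronglyMeasurable fun ρ => ρ ^ (N - 2) *
      ∫ h, chiT f (ρ • e, h) * truncKernel (((N : ℝ) + 2 * s) / 2) ε ρ h := by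
    refine (by fun_prop : Measurable fun ρ : ℝ => ρ ^ (N - 2)).stronglyMeasurable.mul ?_
    exact (hchi.mul (measurable_truncKernel _ ε)).stronglyMeasurable.integral_prod_right'
  rwa [← funext (dirSlice_eq_integral_truncKernel ε)] at h

lemma integral_chiT_mul {w : ℝ → ℝ} (hw : Integrable w) (x : EuclideanSpace ℝ (Fin (N - 1))) :
    ∫ h, chiT f (x, h) * w h = (∫ h in Iic (f x), w h) - ∫ h in Ioi (f x), w h := by
  have h0 : Integrable fun h => chiT f (x, h) * w h := by
    refine hw.bdd_mul (c := 1) ?_ (ae_of_all _ fun h => ?_)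
    · unfold chiT
      exact (Measurable.ite (measurableSet_Iic (a := f x)) measurable_const
        measurable_const).aestronglyMeasurable
    · simp only [chiT]
      split_ifs <;> simp
  rw [← intervalIntegral.integral_Iic_add_Ioi (b := f x) h0.integrableOn h0.integrableOn,
    sub_eq_add_neg, ← integral_neg]
  congr 1
  · refine setIntegral_congr_fun measurableSet_Iic fun h hh => ?_
    simp [chiT, mem_Iic.1 hh]
  · refine setIntegral_congr_fun measurableSet_Ioi fun h hh => ?_
    simp [chiT, not_le.2 (mem_Ioi.1 hh)]

lemma integral_chiT_mul_of_even {w : ℝ → ℝ} (hw : Integrable w) (heven : ∀ h, w (-h) = w h)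
    (x : EuclideanSpace ℝ (Fin (N - 1))) :
    ∫ h, chiT f (x, h) * w h = 2 * ∫ h in (0 : ℝ)..f x, w h := by
  have h1 := intervalIntegral.integral_Iic_sub_Iic (a := 0) (b := f x)
    hw.integrableOn hw.integrableOn
  have h2 := intervalIntegral.integral_Iic_add_Ioi (b := f x) hw.integrableOn hw.integrableOn
  have h3 := intervalIntegral.integral_Iic_add_Ioi (b := (0 : ℝ)) hw.integrableOn hw.integrableOn
  have h4 : ∫ h in Iic (0 : ℝ), w h = ∫ h in Ioi (0 : ℝ), w h := by
    simpa [heven] using integral_comp_neg_Iic 0 w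
  rw [integral_chiT_mul hw]
  linarith

lemma dirSlice_eq (hN : 3 ≤ N) (hs : 0 < s) {ρ : ℝ} (hρ : 0 < ρ) (ε : ℝ) :
    dirSlice N s f e ε ρ = 2 * ρ ^ (N - 2) *
      ∫ h in (0 : ℝ)..f (ρ • e), truncKernel (((N : ℝ) + 2 * s) / 2) ε ρ h := by
  have hN' : (3 : ℝ) ≤ N := by exact_mod_cast hN
  rw [dirSlice_eq_integral_truncKernel, integral_chiT_mul_of_even
    (integrable_truncKernel (by linarith) hρ ε) (truncKernel_neg _ _ _)]
  ring

lemma pow_mul_rpow_kernel (hN : 3 ≤ N) {ρ : ℝ} (hρ : 0 < ρ) (c : ℝ) :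
    ρ ^ (N - 2) * ρ ^ (c - 2 * (((N : ℝ) + 2 * s) / 2)) = ρ ^ (c - 2 - 2 * s) := by
  rw [← Real.rpow_natCast, ← Real.rpow_add hρ, Nat.cast_sub (by omega)]
  congr 1
  push_cast
  ring

lemma abs_dirSlice_le (hN : 3 ≤ N) (hs : 0 < s) {ρ : ℝ} (hρ : 0 < ρ) (ε : ℝ) :
    |dirSlice N s f e ε ρ| ≤ 2 * Real.pi * ρ ^ (-1 - 2 * s) := by
  have hN' : (3 : ℝ) ≤ N := by exact_mod_cast hN
  have hp : 1 ≤ ((N : ℝ) + 2 * s) / 2 := by linarith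
  have hi := integrable_truncKernel hp hρ ε
  have h1 : |∫ h in (0 : ℝ)..f (ρ • e), truncKernel (((N : ℝ) + 2 * s) / 2) ε ρ h| ≤
      Real.pi * ρ ^ (1 - 2 * (((N : ℝ) + 2 * s) / 2)) := by
    refine le_trans ?_ (integral_truncKernel_le hp hρ ε)
    rw [← Real.norm_eq_abs]
    refine intervalIntegral.norm_integral_le_integral_norm_uIoc.trans ?_
    simp_rw [Real.norm_of_nonneg (truncKernel_nonneg _ _ _ _)]
    exact setIntegral_le_integral hi (ae_of_all _ (truncKernel_nonneg _ _ _))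
  rw [dirSlice_eq hN hs hρ, abs_mul, abs_of_pos (by positivity)]
  calc _ ≤ 2 * ρ ^ (N - 2) * (Real.pi * ρ ^ (1 - 2 * (((N : ℝ) + 2 * s) / 2))) := by gcongr
    _ = 2 * Real.pi * (ρ ^ (N - 2) * ρ ^ (1 - 2 * (((N : ℝ) + 2 * s) / 2))) := by ring
    _ = _ := by rw [pow_mul_rpow_kernel hN hρ]; norm_num

lemma abs_dirSlice_le_of_graph (hN : 3 ≤ N) (hs : 0 < s) {ρ : ℝ} (hρ : 0 < ρ) (ε : ℝ) :
    |dirSlice N s f e ε ρ| ≤ 2 * |f (ρ • e)| * ρ ^ (-2 - 2 * s) := by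
  have hN' : (3 : ℝ) ≤ N := by exact_mod_cast hN
  have hp : 1 ≤ ((N : ℝ) + 2 * s) / 2 := by linarith
  have h1 : |∫ h in (0 : ℝ)..f (ρ • e), truncKernel (((N : ℝ) + 2 * s) / 2) ε ρ h| ≤
      ρ ^ (0 - 2 * (((N : ℝ) + 2 * s) / 2)) * |f (ρ • e)| := by
    have := intervalIntegral.norm_integral_le_of_norm_le_const (a := 0) (b := f (ρ • e))
      (f := truncKernel (((N : ℝ) + 2 * s) / 2) ε ρ)
      (C := ρ ^ (0 - 2 * (((N : ℝ) + 2 * s) / 2))) fun h _ => by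
        rw [Real.norm_of_nonneg (truncKernel_nonneg _ _ _ _), zero_sub]
        exact truncKernel_le_rpow hp hρ ε h
    simpa using this
  rw [dirSlice_eq hN hs hρ, abs_mul, abs_of_pos (by positivity)]
  calc _ ≤ 2 * ρ ^ (N - 2) * (ρ ^ (0 - 2 * (((N : ℝ) + 2 * s) / 2)) * |f (ρ • e)|) := by gcongr
    _ = 2 * |f (ρ • e)| * (ρ ^ (N - 2) * ρ ^ (0 - 2 * (((N : ℝ) + 2 * s) / 2))) := by ring
    _ = _ := by rw [pow_mul_rpow_kernel hN hρ]; norm_num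

lemma abs_dirSlice_zero_sub_le (hN : 3 ≤ N) (hs : 0 < s) (hs' : s ≤ 1 / 2) {ρ η : ℝ}
    (hρ : 0 < ρ) (hη : ∀ x ∈ Icc 0 ((f (ρ • e) / ρ) ^ 2), 1 - η ≤ ((1 + x) ^ N)⁻¹) :
    |dirSlice N s f e 0 ρ - 2 * f (ρ • e) * ρ ^ (-2 - 2 * s)| ≤
      2 * η * |f (ρ • e)| * ρ ^ (-2 - 2 * s) := by
  have hN' : (3 : ℝ) ≤ N := by exact_mod_cast hN
  have hp : 1 ≤ ((N : ℝ) + 2 * s) / 2 := by linarith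
  set p := ((N : ℝ) + 2 * s) / 2 with hp_def
  have hpN : p ≤ N := by rw [hp_def]; linarith
  have hk := pow_mul_rpow_kernel (s := s) hN hρ 0
  rw [← hp_def, zero_sub, zero_sub] at hk
  have h1 : |(∫ h in (0 : ℝ)..f (ρ • e), truncKernel p 0 ρ h) - f (ρ • e) * ρ ^ (-(2 * p))| ≤
      η * ρ ^ (-(2 * p)) * |f (ρ • e)| := by
    have h2 := intervalIntegral.norm_integral_le_of_norm_le_const (a := 0) (b := f (ρ • e))
      (f := fun h => truncKernel p 0 ρ h - ρ ^ (-(2 * p)))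
      (C := η * ρ ^ (-(2 * p))) fun h hh => by
        have hx : (h / ρ) ^ 2 ∈ Icc 0 ((f (ρ • e) / ρ) ^ 2) := by
          refine ⟨sq_nonneg _, sq_le_sq.2 ?_⟩
          rw [abs_div, abs_div]
          refine div_le_div_of_nonneg_right ?_ (abs_nonneg ρ)
          simpa using abs_sub_left_of_mem_uIcc (uIoc_subset_uIcc hh)
        have h3 : 1 - η ≤ ((1 + (h / ρ) ^ 2) ^ p)⁻¹ := by
          refine (hη _ hx).trans ?_
          rw [← Real.rpow_natCast]
          gcongr
          nlinarith [sq_nonneg (h / ρ)]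
        have h4 := truncKernel_le_rpow hp hρ 0 h
        have h5 : (0 : ℝ) < ρ ^ (-(2 * p)) := by positivity
        rw [Real.norm_of_nonpos (by linarith), truncKernel_zero hρ]
        nlinarith
    rw [intervalIntegral.integral_sub (integrable_truncKernel hp hρ 0).intervalIntegrable
      intervalIntegrable_const] at h2
    simpa using h2
  rw [dirSlice_eq hN hs hρ, ← hp_def]
  calc _ = 2 * ρ ^ (N - 2) * |(∫ h in (0 : ℝ)..f (ρ • e), truncKernel p 0 ρ h) -
        f (ρ • e) * ρ ^ (-(2 * p))| := by
        rw [← hk, ← abs_of_pos (by positivity : 0 < 2 * ρ ^ (N - 2)), ← abs_mul,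
          abs_of_pos (by positivity : 0 < 2 * ρ ^ (N - 2))]
        ring_nf
    _ ≤ 2 * ρ ^ (N - 2) * (η * ρ ^ (-(2 * p)) * |f (ρ • e)|) := by gcongr
    _ = 2 * η * |f (ρ • e)| * (ρ ^ (N - 2) * ρ ^ (-(2 * p))) := by ring
    _ = _ := by rw [hk]

end Slice

lemma tendsto_div_sq_of_contDiff_two {E : Type*} [NormedAddCommGroup E] [NormedSpace ℝ E]
    {f : E → ℝ} (hf : ContDiff ℝ 2 f) (hf0 : f 0 = 0) (hdf : fderiv ℝ f 0 = 0) (e : E) :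
    Tendsto (fun ρ : ℝ => f (ρ • e) / ρ ^ 2) (𝓝[≠] 0)
      (𝓝 (iteratedFDeriv ℝ 2 f 0 ![e, e] / 2)) := by
  set L : ℝ →L[ℝ] E := ContinuousLinearMap.toSpanSingleton ℝ e
  have hL : ∀ ρ : ℝ, (f ∘ L) ρ = f (ρ • e) := fun ρ => by simp [L]
  have hg : ContDiff ℝ 2 (f ∘ L) := hf.comp L.contDiff
  have h1 : iteratedDeriv 1 (f ∘ L) 0 = 0 := by
    rw [iteratedDeriv_one, ← fderiv_apply_one_eq_deriv, fderiv_comp _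
      (hf.differentiable (by norm_num)).differentiableAt L.differentiableAt]
    simp [hdf]
  have h2 : iteratedDeriv 2 (f ∘ L) 0 = iteratedFDeriv ℝ 2 f 0 ![e, e] := by
    rw [iteratedDeriv_eq_iteratedFDeriv, L.iteratedFDeriv_comp_right hf 0 le_rfl]
    simp only [map_zero, ContinuousMultilinearMap.compContinuousLinearMap_apply]
    congr 1
    funext i
    fin_cases i <;> simp [L]
  have ho := taylor_isLittleO_univ (x₀ := 0) (n := 2) hg
  have ht := ho.tendsto_div_nhds_zero
  have h3 : ∀ x : ℝ, taylorWithinEval (f ∘ L) 2 univ 0 x =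
      iteratedFDeriv ℝ 2 f 0 ![e, e] / 2 * x ^ 2 := fun x => by
    rw [taylorWithinEval_succ, taylorWithinEval_succ, taylor_within_zero_eval]
    simp only [iteratedDerivWithin_univ, zero_add, h1, h2, one_add_one_eq_two]
    simp [hf0]
    ring
  have h4 := (ht.mono_left (nhdsWithin_le_nhds (s := {0}ᶜ))).add_const
    (iteratedFDeriv ℝ 2 f 0 ![e, e] / 2)
  rw [zero_add] at h4
  refine h4.congr' ?_
  filter_upwards [self_mem_nhdsWithin] with x hx
  have hx' : x ≠ 0 := hx
  rw [h3, hL, sub_zero]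
  field_simp
  ring

lemma integrableOn_Ioc_zero_rpow {s δ : ℝ} (hs : s < 1 / 2) (hδ : 0 ≤ δ) :
    IntegrableOn (fun ρ : ℝ => ρ ^ (-2 * s)) (Ioc 0 δ) :=
  (intervalIntegrable_iff_integrableOn_Ioc_of_le hδ).1
    (intervalIntegral.intervalIntegrable_rpow' (by linarith))

lemma integral_Ioc_zero_rpow {s δ : ℝ} (hs : s < 1 / 2) (hδ : 0 ≤ δ) :
    ∫ ρ in Ioc 0 δ, ρ ^ (-2 * s) = δ ^ (1 - 2 * s) / (1 - 2 * s) := by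
  rw [← intervalIntegral.integral_of_le hδ, integral_rpow (Or.inl (by linarith)),
    show -2 * s + 1 = 1 - 2 * s by ring, Real.zero_rpow (by linarith), sub_zero]

/-- An Abelian theorem: if `J s ρ ~ a ρ^{-2s}` at the origin and `J s ρ = O(ρ^{-1-2s})` at
infinity, uniformly in `s`, then `(1 - 2s) ∫₀^∞ J s → a` as `s ↑ 1/2`. -/
lemma tendsto_one_sub_mul_integral {J : ℝ → ℝ → ℝ} {a C : ℝ}
    (hint : ∀ s ∈ Ioo (0 : ℝ) (1 / 2), IntegrableOn (J s) (Ioi 0))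
    (hfar : ∀ s ∈ Ioo (0 : ℝ) (1 / 2), ∀ ρ > 0, |J s ρ| ≤ C * ρ ^ (-1 - 2 * s))
    (hnear : ∀ η > 0, ∃ δ > 0, ∀ s ∈ Ioo (0 : ℝ) (1 / 2), ∀ ρ ∈ Ioc 0 δ,
      |J s ρ - a * ρ ^ (-2 * s)| ≤ η * ρ ^ (-2 * s)) :
    Tendsto (fun s => (1 - 2 * s) * ∫ ρ in Ioi 0, J s ρ)
      (𝓝[Ioo 0 (1 / 2)] (1 / 2)) (𝓝 a) := by
  rw [Metric.tendsto_nhds]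
  intro η hη
  obtain ⟨δ, hδ, hnear⟩ := hnear (η / 2) (by positivity)
  set B : ℝ → ℝ := fun s => η / 2 * δ ^ (1 - 2 * s) + |a| * |δ ^ (1 - 2 * s) - 1| +
    (1 - 2 * s) * (C * (δ ^ (-2 * s) / (2 * s))) with hB
  have hBlim : Tendsto B (𝓝[Ioo 0 (1 / 2)] (1 / 2)) (𝓝 (η / 2)) := by
    have h1 : ContinuousAt B (1 / 2) := by
      have hc1 : ContinuousAt (fun s : ℝ => δ ^ (1 - 2 * s)) (1 / 2) :=
        continuousAt_const.rpow (by fun_prop) (Or.inl hδ.ne')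
      have hc2 : ContinuousAt (fun s : ℝ => δ ^ (-2 * s)) (1 / 2) :=
        continuousAt_const.rpow (by fun_prop) (Or.inl hδ.ne')
      have hc3 : ContinuousAt (fun s : ℝ => δ ^ (-2 * s) / (2 * s)) (1 / 2) :=
        hc2.div (by fun_prop) (by norm_num)
      fun_prop
    have h2 : B (1 / 2) = η / 2 := by simp [hB]
    rw [← h2]
    exact h1.tendsto.mono_left nhdsWithin_le_nhds
  filter_upwards [hBlim.eventually_lt_const (half_lt_self hη), self_mem_nhdsWithin] with s hs hsI
  refine lt_of_le_of_lt ?_ hs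
  obtain ⟨hs0, hs1⟩ := hsI
  have hpos : 0 < 1 - 2 * s := by linarith
  have hsplit : ∫ ρ in Ioi 0, J s ρ = (∫ ρ in Ioc 0 δ, J s ρ) + ∫ ρ in Ioi δ, J s ρ := by
    rw [← Ioc_union_Ioi_eq_Ioi hδ.le]
    exact setIntegral_union Ioc_disjoint_Ioi_same measurableSet_Ioi
      ((hint s ⟨hs0, hs1⟩).mono_set Ioc_subset_Ioi_self)
      ((hint s ⟨hs0, hs1⟩).mono_set (Ioi_subset_Ioi hδ.le))
  have hI := integrableOn_Ioc_zero_rpow hs1 hδ.le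
  have hsmall : |(∫ ρ in Ioc 0 δ, J s ρ) - a * (δ ^ (1 - 2 * s) / (1 - 2 * s))| ≤
      η / 2 * (δ ^ (1 - 2 * s) / (1 - 2 * s)) := by
    rw [← integral_Ioc_zero_rpow hs1 hδ.le, ← integral_const_mul, ← integral_const_mul,
      ← integral_sub ((hint s ⟨hs0, hs1⟩).mono_set Ioc_subset_Ioi_self) (hI.const_mul a),
      ← Real.norm_eq_abs]
    refine norm_integral_le_of_norm_le (hI.const_mul _) ?_
    filter_upwards [ae_restrict_mem measurableSet_Ioc] with ρ hρ
    exact hnear s ⟨hs0, hs1⟩ ρ hρ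
  have hlarge : |∫ ρ in Ioi δ, J s ρ| ≤ C * (δ ^ (-2 * s) / (2 * s)) := by
    have h1 : ∫ ρ in Ioi δ, ρ ^ (-1 - 2 * s) = δ ^ (-2 * s) / (2 * s) := by
      rw [integral_Ioi_rpow_of_lt (by linarith) hδ, show -1 - 2 * s + 1 = -2 * s by ring,
        neg_mul, div_neg, neg_div, neg_neg]
    rw [← h1, ← integral_const_mul, ← Real.norm_eq_abs]
    refine norm_integral_le_of_norm_le
      ((integrableOn_Ioi_rpow_of_lt (by linarith) hδ).const_mul _) ?_
    filter_upwards [ae_restrict_mem measurableSet_Ioi] with ρ hρ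
    exact hfar s ⟨hs0, hs1⟩ ρ (hδ.trans hρ)
  set X := ∫ ρ in Ioc 0 δ, J s ρ
  set Y := ∫ ρ in Ioi δ, J s ρ
  set D := δ ^ (1 - 2 * s)
  have hdecomp : (1 - 2 * s) * (X + Y) - a =
      (1 - 2 * s) * (X - a * (D / (1 - 2 * s))) + a * (D - 1) + (1 - 2 * s) * Y := by
    field_simp
    ring
  rw [Real.dist_eq, hsplit, hdecomp]
  refine (abs_add_three _ _ _).trans ?_
  rw [abs_mul, abs_mul, abs_mul, abs_of_pos hpos]
  have h1 : (1 - 2 * s) * |X - a * (D / (1 - 2 * s))| ≤ η / 2 * D := by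
    calc _ ≤ (1 - 2 * s) * (η / 2 * (D / (1 - 2 * s))) := by gcongr
      _ = η / 2 * D := by field_simp
  have h2 : (1 - 2 * s) * |Y| ≤ (1 - 2 * s) * (C * (δ ^ (-2 * s) / (2 * s))) := by gcongr
  simp only [hB]
  linarith

section Curvature

variable {N : ℕ} {s : ℝ} {f : EuclideanSpace ℝ (Fin (N - 1)) → ℝ}
  {e : EuclideanSpace ℝ (Fin (N - 1))}

lemma rpow_sub_two_mul_sq {ρ : ℝ} (hρ : 0 < ρ) (s : ℝ) :
    ρ ^ (-2 - 2 * s) * ρ ^ 2 = ρ ^ (-2 * s) := by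
  rw [← Real.rpow_two, ← Real.rpow_add hρ]
  ring_nf

lemma exists_integrableOn_dirSlice_bound (hN : 3 ≤ N) (hs : s ∈ Ioo (0 : ℝ) (1 / 2)) {C δ : ℝ}
    (hδ : 0 < δ) (hC : ∀ ρ ∈ Ioc 0 δ, |f (ρ • e)| ≤ C * ρ ^ 2) :
    ∃ B : ℝ → ℝ, IntegrableOn B (Ioi 0) ∧ ∀ ε, ∀ ρ > 0, |dirSlice N s f e ε ρ| ≤ B ρ := by
  refine ⟨fun ρ => if ρ ≤ δ then 2 * C * ρ ^ (-2 * s) else 2 * Real.pi * ρ ^ (-1 - 2 * s),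
    ?_, fun ε ρ hρ => ?_⟩
  · rw [← Ioc_union_Ioi_eq_Ioi hδ.le]
    refine IntegrableOn.union ?_ ?_
    · refine IntegrableOn.congr_fun
        ((integrableOn_Ioc_zero_rpow hs.2 hδ.le).const_mul (2 * C))
        (fun ρ hρ => ?_) measurableSet_Ioc
      simp [hρ.2]
    · refine IntegrableOn.congr_fun
        ((integrableOn_Ioi_rpow_of_lt (by linarith [hs.1] : -1 - 2 * s < -1)
          hδ).const_mul (2 * Real.pi)) (fun ρ hρ => ?_) measurableSet_Ioi
      simp [not_le.2 (mem_Ioi.1 hρ)]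
  · dsimp only
    split_ifs with h
    · refine (abs_dirSlice_le_of_graph hN hs.1 hρ ε).trans ?_
      calc _ ≤ 2 * (C * ρ ^ 2) * ρ ^ (-2 - 2 * s) := by
            gcongr
            exact hC ρ ⟨hρ, h⟩
        _ = 2 * C * (ρ ^ (-2 - 2 * s) * ρ ^ 2) := by ring
        _ = _ := by rw [rpow_sub_two_mul_sq hρ]
    · exact abs_dirSlice_le hN hs.1 hρ ε

lemma integrableOn_dirSlice (hN : 3 ≤ N) (hs : s ∈ Ioo (0 : ℝ) (1 / 2)) (hf : Continuous f)
    {C δ : ℝ} (hδ : 0 < δ) (hC : ∀ ρ ∈ Ioc 0 δ, |f (ρ • e)| ≤ C * ρ ^ 2) (ε : ℝ) :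
    IntegrableOn (dirSlice N s f e ε) (Ioi 0) := by
  obtain ⟨B, hB, hle⟩ := exists_integrableOn_dirSlice_bound hN hs hδ hC
  refine hB.mono' (stronglyMeasurable_dirSlice hf ε).aestronglyMeasurable ?_
  filter_upwards [ae_restrict_mem measurableSet_Ioi] with ρ hρ
  exact hle ε ρ hρ

lemma hasDirCurv_integral_dirSlice (hN : 3 ≤ N) (hs : s ∈ Ioo (0 : ℝ) (1 / 2))
    (hf : Continuous f) {C δ : ℝ} (hδ : 0 < δ)
    (hC : ∀ ρ ∈ Ioc 0 δ, |f (ρ • e)| ≤ C * ρ ^ 2) :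
    HasDirCurv N s f e (∫ ρ in Ioi 0, dirSlice N s f e 0 ρ) := by
  obtain ⟨B, hB, hle⟩ := exists_integrableOn_dirSlice_bound hN hs hδ hC
  refine tendsto_integral_filter_of_dominated_convergence B
    (Eventually.of_forall fun ε => (stronglyMeasurable_dirSlice hf ε).aestronglyMeasurable)
    (Eventually.of_forall fun ε => ?_) hB ?_
  · filter_upwards [ae_restrict_mem measurableSet_Ioi] with ρ hρ
    exact hle ε ρ hρ
  · filter_upwards [ae_restrict_mem measurableSet_Ioi] with ρ hρ
    refine tendsto_const_nhds.congr' ?_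
    filter_upwards [Ioc_mem_nhdsGT (mem_Ioi.1 hρ)] with ε hε
    change dirSlice N s f e 0 ρ = dirSlice N s f e ε ρ
    rw [dirSlice_eq_integral_truncKernel, dirSlice_eq_integral_truncKernel,
      truncKernel_eq_of_le hε.1.le hε.2]

lemma exists_dirSlice_near (hN : 3 ≤ N) {a : ℝ}
    (hlim : Tendsto (fun ρ : ℝ => f (ρ • e) / ρ ^ 2) (𝓝[>] 0) (𝓝 (a / 2))) {η : ℝ} (hη : 0 < η) :
    ∃ δ > 0, ∀ s ∈ Ioo (0 : ℝ) (1 / 2), ∀ ρ ∈ Ioc 0 δ,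
      |dirSlice N s f e 0 ρ - a * ρ ^ (-2 * s)| ≤ η * ρ ^ (-2 * s) := by
  set M : ℝ := |a / 2| + 1 with hM
  have hMpos : 0 < M := by positivity
  set θ : ℝ := η / (4 * M) with hθ
  have hθpos : 0 < θ := by positivity
  have hbern : ∀ᶠ x : ℝ in 𝓝 0, 1 - θ < ((1 + x) ^ N)⁻¹ := by
    have : ContinuousAt (fun x : ℝ => ((1 + x) ^ N)⁻¹) 0 :=
      ContinuousAt.inv₀ (by fun_prop) (by simp)
    exact this.tendsto.eventually_const_lt (by simpa using hθpos)
  obtain ⟨r, hr, hbern⟩ := Metric.eventually_nhds_iff.1 hbern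
  have hquad : ∀ᶠ ρ : ℝ in 𝓝[>] 0, (M * ρ) ^ 2 < r := by
    have : Tendsto (fun ρ : ℝ => (M * ρ) ^ 2) (𝓝 0) (𝓝 0) := by
      have : Continuous fun ρ : ℝ => (M * ρ) ^ 2 := by fun_prop
      simpa using this.tendsto 0
    exact (this.mono_left nhdsWithin_le_nhds).eventually_lt_const hr
  have hclose := (Metric.tendsto_nhds.1 hlim) (min 1 (η / 4)) (by positivity)
  obtain ⟨δ, hδ, hsub⟩ := mem_nhdsGT_iff_exists_Ioc_subset.1 (hquad.and hclose)
  refine ⟨δ, hδ, fun s hs ρ hρ => ?_⟩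
  obtain ⟨hq, hc⟩ := hsub hρ
  have hρ0 : 0 < ρ := hρ.1
  rw [Real.dist_eq, lt_min_iff] at hc
  set q := f (ρ • e) / ρ ^ 2 with hq_def
  have hfq : f (ρ • e) = q * ρ ^ 2 := by rw [hq_def]; field_simp
  have hqM : |q| ≤ M := by
    have := abs_sub_abs_le_abs_sub q (a / 2)
    rw [hM]
    linarith [hc.1]
  have h1 := abs_dirSlice_zero_sub_le (f := f) (e := e) (η := θ) hN hs.1 hs.2.le hρ0
    fun x hx => by
      refine (hbern ?_).le
      rw [Real.dist_eq, sub_zero, abs_of_nonneg hx.1]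
      refine lt_of_le_of_lt (hx.2.trans ?_) hq
      rw [hfq, show q * ρ ^ 2 / ρ = q * ρ by field_simp, sq_le_sq, abs_mul, abs_mul,
        abs_of_pos hMpos]
      gcongr
  rw [hfq, abs_mul, abs_of_pos (by positivity : 0 < ρ ^ 2),
    show 2 * (q * ρ ^ 2) * ρ ^ (-2 - 2 * s) = 2 * q * (ρ ^ (-2 - 2 * s) * ρ ^ 2) by ring,
    show 2 * θ * (|q| * ρ ^ 2) * ρ ^ (-2 - 2 * s) =
      2 * θ * |q| * (ρ ^ (-2 - 2 * s) * ρ ^ 2) by ring, rpow_sub_two_mul_sq hρ0] at h1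
  have hP : 0 < ρ ^ (-2 * s) := by positivity
  have h2 : 2 * θ * |q| * ρ ^ (-2 * s) ≤ η / 2 * ρ ^ (-2 * s) := by
    gcongr
    calc 2 * θ * |q| ≤ 2 * θ * M := by gcongr
      _ = η / 2 := by rw [hθ]; field_simp; norm_num
  have h3 : |2 * q * ρ ^ (-2 * s) - a * ρ ^ (-2 * s)| ≤ η / 2 * ρ ^ (-2 * s) := by
    rw [show 2 * q * ρ ^ (-2 * s) - a * ρ ^ (-2 * s) = 2 * (q - a / 2) * ρ ^ (-2 * s) by ring,
      abs_mul, abs_mul, abs_of_pos hP, abs_two]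
    gcongr
    linarith [hc.2]
  have h4 := abs_sub_le (dirSlice N s f e 0 ρ) (2 * q * ρ ^ (-2 * s)) (a * ρ ^ (-2 * s))
  linarith

end Curvature

/-- **Asymptotics of the nonlocal directional curvature as `s ↑ 1/2`**: for every unit
direction `e`, `(1−2s)·K_{s,e} → ⟨D²f(0)·e, e⟩` as `s ↑ 1/2`. -/
theorem nonlocal_dir_curv_asymptotics (N : ℕ) (hN : 3 ≤ N)
    (f : EuclideanSpace ℝ (Fin (N - 1)) → ℝ) (hf : ContDiff ℝ 2 f)
    (hf0 : f 0 = 0) (hdf : fderiv ℝ f 0 = 0)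
    (e : EuclideanSpace ℝ (Fin (N - 1))) (he : ‖e‖ = 1)
    (K : ℝ → ℝ) (hK : ∀ s ∈ Set.Ioo (0 : ℝ) (1 / 2), HasDirCurv N s f e (K s)) :
    Tendsto (fun s : ℝ => (1 - 2 * s) * K s)
      (nhdsWithin (1 / 2) (Set.Ioo 0 (1 / 2)))
      (nhds (iteratedFDeriv ℝ 2 f 0 ![e, e])) := by
  have hlim : Tendsto (fun ρ : ℝ => f (ρ • e) / ρ ^ 2) (𝓝[>] 0)
      (𝓝 (iteratedFDeriv ℝ 2 f 0 ![e, e] / 2)) :=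
    (tendsto_div_sq_of_contDiff_two hf hf0 hdf e).mono_left
      (nhdsWithin_mono _ fun _ hx => (mem_Ioi.1 hx).ne')
  obtain ⟨δ, hδ, hsub⟩ := mem_nhdsGT_iff_exists_Ioc_subset.1
    (hlim.abs.eventually_lt_const (lt_add_one _))
  have hC : ∀ ρ ∈ Ioc 0 δ,
      |f (ρ • e)| ≤ (|iteratedFDeriv ℝ 2 f 0 ![e, e] / 2| + 1) * ρ ^ 2 := fun ρ hρ => by
    have hρ2 : 0 < ρ ^ 2 := pow_pos hρ.1 2
    have h : |f (ρ • e) / ρ ^ 2| < _ := hsub hρ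
    rw [abs_div, abs_of_pos hρ2, div_lt_iff₀ hρ2] at h
    exact h.le
  refine (tendsto_one_sub_mul_integral (J := fun s => dirSlice N s f e 0)
    (fun s hs => integrableOn_dirSlice hN hs hf.continuous hδ hC 0)
    (fun s hs ρ hρ => abs_dirSlice_le hN hs.1 hρ 0)
    fun η hη => exists_dirSlice_near hN hlim hη).congr' ?_
  filter_upwards [self_mem_nhdsWithin] with s hs
  rw [tendsto_nhds_unique (hK s hs)
    (hasDirCurv_integral_dirSlice hN hs hf.continuous hδ hC)]
end
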